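/- arXiv:2402.16066 — 4 statements merged into one kernel-verified Lean document; each statement's English description precedes it below -/
import Mathlib

section
/- For every integer n ≥ 12 there exists a nonhamiltonian locally linear graph with exactly n vertices and exactly 2n edges. -/
/-- A graph is locally linear (in the sense of this paper) if the neighborhood
of every vertex induces a path. -/
def LocallyPath {V : Type*} (G : SimpleGraph V) : Prop :=
  ∀ v : V, ∃ n : ℕ,
    Nonempty ((G.induce (G.neighborSet v)) ≃g SimpleGraph.pathGraph (n + 1))

namespace SimpleGraph

section Link

variable {V W : Type*} {G : SimpleGraph V} {H : SimpleGraph W}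

/-- The neighborhood of `v` induces a path that has `y` as one of its ends. -/
def LinkEndsAt (G : SimpleGraph V) (v y : V) : Prop :=
  ∃ (k : ℕ) (f : pathGraph (k + 1) ↪g G), Set.range f = G.neighborSet v ∧ f (Fin.last k) = y

theorem locallyPath_of_linkEndsAt (h : ∀ v, ∃ y, G.LinkEndsAt v y) : LocallyPath G := by
  intro v
  obtain ⟨y, k, f, hf, -⟩ := h v
  exact ⟨k, ⟨hf ▸ f.isoInduceRange.symm⟩⟩

theorem LinkEndsAt.of_fun {v : V} {k : ℕ} (f : Fin (k + 1) → V)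
    (hinj : ∀ i j, f i = f j → i = j) (hrange : ∀ x, G.Adj v x ↔ ∃ i, f i = x)
    (hadj : ∀ i j, G.Adj (f i) (f j) ↔ i.val + 1 = j.val ∨ j.val + 1 = i.val) :
    G.LinkEndsAt v (f (Fin.last k)) := by
  refine ⟨k, ⟨⟨f, fun i j => hinj i j⟩, ?_⟩, ?_, rfl⟩
  · intro i j
    rw [pathGraph_adj]
    exact hadj i j
  · ext x
    exact (hrange x).symm

/-- An embedding that adds no new neighbors to `v` preserves its link. -/
theorem LinkEndsAt.map {v y : V} (h : G.LinkEndsAt v y) (φ : G ↪g H)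
    (hN : H.neighborSet (φ v) = φ '' G.neighborSet v) : H.LinkEndsAt (φ v) (φ y) := by
  obtain ⟨k, f, hf, rfl⟩ := h
  refine ⟨k, f.trans φ, ?_, rfl⟩
  rw [hN, ← hf, ← Set.range_comp]
  rfl

/-- A new neighbor of `v` that is attached to the end of its link becomes the end. -/
theorem LinkEndsAt.snoc {v y : V} (h : G.LinkEndsAt v y) (φ : G ↪g H) {z : W}
    (hz : z ∉ Set.range φ) (hN : H.neighborSet (φ v) = insert z (φ '' G.neighborSet v))
    (hadj : ∀ t ∈ G.neighborSet v, H.Adj z (φ t) ↔ t = y) : H.LinkEndsAt (φ v) z := by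
  obtain ⟨k, f, hf, rfl⟩ := h
  have key := LinkEndsAt.of_fun (G := H) (v := φ v)
    (Fin.snoc (α := fun _ => W) (fun i => φ (f i)) z) ?_ ?_ ?_
  · simpa using key
  · have hz' : ∀ t, φ t ≠ z := fun t ht => hz ⟨t, ht⟩
    intro i j
    cases i using Fin.lastCases <;> cases j using Fin.lastCases <;>
      simp [hz', (hz' _).symm]
  · intro x
    rw [← mem_neighborSet, hN, ← hf, Fin.exists_fin_succ']
    simp [eq_comm, or_comm]
  · have hlast : ∀ i, H.Adj z (φ (f i)) ↔ i = Fin.last k := fun i => by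
      rw [hadj _ (hf ▸ Set.mem_range_self i), f.injective.eq_iff]
    intro i j
    cases i using Fin.lastCases <;> cases j using Fin.lastCases <;>
      simp [hlast, H.adj_comm _ z, pathGraph_adj, Fin.ext_iff] <;> omega

end Link

section AddEar

variable {n : ℕ} (G : SimpleGraph (Fin n)) (x y : Fin n)

/-- Add a new vertex to `G` that is adjacent to `x` and `y` only. -/
def addEar : SimpleGraph (Fin (n + 1)) :=
  G.map Fin.castSuccEmb ⊔ (edge (Fin.last n) x.castSucc ⊔ edge (Fin.last n) y.castSucc)

variable {G x y}

@[simp]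
theorem addEar_adj_castSucc {a b : Fin n} :
    (G.addEar x y).Adj a.castSucc b.castSucc ↔ G.Adj a b := by
  rw [addEar, sup_adj, map_adj]
  simp [edge_adj]

@[simp]
theorem addEar_adj_last {a : Fin n} :
    (G.addEar x y).Adj (Fin.last n) a.castSucc ↔ a = x ∨ a = y := by
  rw [addEar, sup_adj, map_adj]
  simp [edge_adj, (Fin.castSucc_ne_last _).symm]

@[simp]
theorem addEar_adj_last_right {a : Fin n} :
    (G.addEar x y).Adj a.castSucc (Fin.last n) ↔ a = x ∨ a = y := by
  rw [adj_comm, addEar_adj_last]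

variable (G x y) in
/-- The old graph is an induced subgraph of the new one. -/
def addEarEmbedding : G ↪g G.addEar x y where
  toEmbedding := Fin.castSuccEmb
  map_rel_iff' := addEar_adj_castSucc

@[simp]
theorem addEarEmbedding_apply (a : Fin n) : addEarEmbedding G x y a = a.castSucc := rfl

theorem Connected.addEar (h : G.Connected) : (G.addEar x y).Connected := by
  rw [connected_iff_exists_forall_reachable]
  refine ⟨x.castSucc, fun w => ?_⟩
  cases w using Fin.lastCases with
  | last => exact Adj.reachable (by simp)
  | cast a => exact (h.preconnected x a).map (addEarEmbedding G x y).toHom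

theorem ncard_edgeSet_addEar (hxy : x ≠ y) :
    (G.addEar x y).edgeSet.ncard = G.edgeSet.ncard + 2 := by
  have hne : s(Fin.last n, x.castSucc) ≠ s(Fin.last n, y.castSucc) := by simpa using hxy
  have hdisj : Disjoint (Fin.castSuccEmb.sym2Map '' G.edgeSet)
      {s(Fin.last n, x.castSucc), s(Fin.last n, y.castSucc)} := by
    rw [← edgeSet_map, Set.disjoint_left]
    rintro e he (rfl | rfl) <;> rw [mem_edgeSet, map_adj] at he <;> simp at he
  rw [SimpleGraph.addEar, edgeSet_sup, edgeSet_sup, edgeSet_map,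
    edgeSet_edge_of_ne (Fin.castSucc_ne_last _).symm,
    edgeSet_edge_of_ne (Fin.castSucc_ne_last _).symm, Set.singleton_union,
    Set.ncard_union_eq hdisj, Set.ncard_pair hne,
    Set.ncard_image_of_injective _ Fin.castSuccEmb.sym2Map.injective]

theorem neighborSet_addEar_castSucc_of_ne {v : Fin n} (hx : v ≠ x) (hy : v ≠ y) :
    (G.addEar x y).neighborSet v.castSucc = Fin.castSucc '' G.neighborSet v := by
  ext w
  cases w using Fin.lastCases <;> simp [hx, hy]

theorem neighborSet_addEar_castSucc {v : Fin n} (hv : v = x ∨ v = y) :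
    (G.addEar x y).neighborSet v.castSucc =
      insert (Fin.last n) (Fin.castSucc '' G.neighborSet v) := by
  ext w
  cases w using Fin.lastCases <;> simp [hv]

theorem linkEndsAt_addEar_left (h : G.LinkEndsAt x y) :
    (G.addEar x y).LinkEndsAt x.castSucc (Fin.last n) := by
  refine h.snoc (addEarEmbedding G x y) (by simp)
    (neighborSet_addEar_castSucc (.inl rfl)) fun t ht => ?_
  have : t ≠ x := (G.ne_of_adj ht).symm
  simp [this]

theorem linkEndsAt_addEar_right (h : G.LinkEndsAt y x) :
    (G.addEar x y).LinkEndsAt y.castSucc (Fin.last n) := by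
  refine h.snoc (addEarEmbedding G x y) (by simp)
    (neighborSet_addEar_castSucc (.inr rfl)) fun t ht => ?_
  have : t ≠ y := (G.ne_of_adj ht).symm
  simp [this]

theorem linkEndsAt_addEar_last (hxy : G.Adj x y) :
    (G.addEar x y).LinkEndsAt (Fin.last n) x.castSucc := by
  refine LinkEndsAt.of_fun (k := 1) ![y.castSucc, x.castSucc] ?_ ?_ ?_
  · simp [Fin.forall_fin_two, hxy.ne, hxy.ne.symm]
  · intro w
    cases w using Fin.lastCases <;> simp [Fin.exists_fin_two, eq_comm, or_comm]
  · simp [Fin.forall_fin_two, hxy, hxy.symm]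

theorem exists_linkEndsAt_addEar (hxy : G.Adj x y) (hx : G.LinkEndsAt x y)
    (hy : G.LinkEndsAt y x) (h : ∀ v, ∃ t, G.LinkEndsAt v t) (v : Fin (n + 1)) :
    ∃ t, (G.addEar x y).LinkEndsAt v t := by
  cases v using Fin.lastCases with
  | last => exact ⟨_, linkEndsAt_addEar_last hxy⟩
  | cast v =>
    by_cases hvx : v = x
    · exact ⟨_, by rw [hvx]; exact linkEndsAt_addEar_left hx⟩
    by_cases hvy : v = y
    · exact ⟨_, by rw [hvy]; exact linkEndsAt_addEar_right hy⟩
    obtain ⟨t, ht⟩ := h v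
    exact ⟨_, ht.map (addEarEmbedding G x y) (neighborSet_addEar_castSucc_of_ne hvx hvy)⟩

end AddEar

section Hamiltonian

variable {V ι : Type*} [DecidableEq V] {G : SimpleGraph V}

/-- A Hamiltonian cycle visits no vertex outside of a closed chain
`u i, w i, u (σ i), w (σ i), …` whose vertices `w i` have no further neighbors. -/
theorem Walk.IsHamiltonianCycle.mem_range_of_neighborSet_subset_pair {a : V} {p : G.Walk a a}
    (hp : p.IsHamiltonianCycle) [Nonempty ι] (σ : Equiv.Perm ι) (hσ : ∀ i, σ i ≠ i)
    {u w : ι → V} (hw : Function.Injective w)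
    (hN : ∀ i, G.neighborSet (w i) ⊆ {u i, u (σ i)}) (b : V) :
    b ∈ Set.range u ∪ Set.range w := by
  have hcard (c : V) : (p.toSubgraph.neighborSet c).ncard = 2 :=
    hp.isCycle.ncard_neighborSet_toSubgraph_eq_two (hp.mem_support c)
  have hNw (i : ι) : p.toSubgraph.neighborSet (w i) = {u i, u (σ i)} :=
    Set.eq_of_subset_of_ncard_le ((p.toSubgraph.neighborSet_subset _).trans (hN i))
      (((Set.ncard_insert_le _ _).trans (by simp)).trans (hcard _).ge) (Set.toFinite _)
  have hNw' (i : ι) : p.toSubgraph.Adj (w i) (u i) ∧ p.toSubgraph.Adj (w i) (u (σ i)) := by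
    simp [← Subgraph.mem_neighborSet, hNw]
  have hNu (i : ι) : p.toSubgraph.neighborSet (u (σ i)) = {w i, w (σ i)} := by
    refine (Set.eq_of_subset_of_ncard_le ?_ ?_ (p.finite_neighborSet_toSubgraph)).symm
    · rintro _ (rfl | rfl)
      · exact (hNw' i).2.symm
      · exact (hNw' (σ i)).1.symm
    · rw [hcard, Set.ncard_pair (hw.ne (hσ i).symm)]
  by_contra hb
  obtain ⟨i⟩ := ‹Nonempty ι›
  let q := p.rotate (w i) (hp.mem_support _)
  have hbq : b ∈ q.support := by
    simpa [q] using hp.mem_support b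
  obtain ⟨d, hd, hfst, hsnd⟩ := (q.takeUntil b hbq).exists_boundary_dart
    (Set.range u ∪ Set.range w) (.inr ⟨i, rfl⟩) hb
  have hadj : d.snd ∈ p.toSubgraph.neighborSet d.fst := by
    rw [Subgraph.mem_neighborSet, Walk.adj_toSubgraph_iff_mem_edges]
    have hq : d.edge ∈ q.edges := q.edges_takeUntil_subset_edges hbq (List.mem_map_of_mem hd)
    exact (p.rotate_edges _ _).mem_iff.1 hq
  rcases hfst with ⟨j, hj⟩ | ⟨j, hj⟩
  · rw [← hj, ← σ.apply_symm_apply j, hNu] at hadj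
    rcases hadj with h | h <;> exact hsnd (.inr ⟨_, h.symm⟩)
  · rw [← hj, hNw] at hadj
    rcases hadj with h | h <;> exact hsnd (.inl ⟨_, h.symm⟩)

end Hamiltonian

section EaredAntiprism

/-- The square antiprism with squares `{0, …, 3}` and `{8, …, 11}` in which every edge of the
former square is joined to a new vertex from `{4, …, 7}`. -/
def earedAntiprism : SimpleGraph (Fin 12) :=
  fromRel fun a b =>
    (b.val % 4 = (a.val + 1) % 4 ∧
        (a.val / 4 = b.val / 4 ∧ a.val / 4 ≠ 1 ∨ b.val < 4 ∧ 4 ≤ a.val)) ∨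
      (b.val % 4 = a.val % 4 ∧ b.val < 4 ∧ 4 ≤ a.val)

instance : DecidableRel earedAntiprism.Adj :=
  inferInstanceAs (DecidableRel (fromRel _).Adj)

/-- The base square of the eared antiprism. -/
def baseVertex (i : Fin 4) : Fin 12 := ⟨i, by omega⟩

/-- The ears of the eared antiprism. -/
def earVertex (i : Fin 4) : Fin 12 := ⟨i + 4, by omega⟩

/-- The top square of the eared antiprism. -/
def topVertex (i : Fin 4) : Fin 12 := ⟨i + 8, by omega⟩

theorem linkEndsAt_earedAntiprism_base (i : Fin 4) :
    earedAntiprism.LinkEndsAt (baseVertex i) (earVertex (i - 1)) := by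
  refine LinkEndsAt.of_fun (k := 5)
    ![earVertex i, baseVertex (i + 1), topVertex i, topVertex (i - 1), baseVertex (i - 1),
      earVertex (i - 1)] ?_ ?_ ?_ <;> revert i <;> decide

theorem linkEndsAt_earedAntiprism_ear (i : Fin 4) :
    earedAntiprism.LinkEndsAt (earVertex i) (baseVertex i) := by
  refine LinkEndsAt.of_fun (k := 1) ![baseVertex (i + 1), baseVertex i] ?_ ?_ ?_ <;>
    revert i <;> decide

theorem linkEndsAt_earedAntiprism_top (i : Fin 4) :
    earedAntiprism.LinkEndsAt (topVertex i) (topVertex (i + 1)) := by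
  refine LinkEndsAt.of_fun (k := 3)
    ![topVertex (i - 1), baseVertex i, baseVertex (i + 1), topVertex (i + 1)] ?_ ?_ ?_ <;>
    revert i <;> decide

theorem linkEndsAt_earedAntiprism_top_sub (i : Fin 4) :
    earedAntiprism.LinkEndsAt (topVertex i) (topVertex (i - 1)) := by
  refine LinkEndsAt.of_fun (k := 3)
    ![topVertex (i + 1), baseVertex (i + 1), baseVertex i, topVertex (i - 1)] ?_ ?_ ?_ <;>
    revert i <;> decide

theorem exists_linkEndsAt_earedAntiprism (v : Fin 12) :
    ∃ y, earedAntiprism.LinkEndsAt v y := by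
  have hv : ∀ v, ∃ i, v = baseVertex i ∨ v = earVertex i ∨ v = topVertex i := by decide
  obtain ⟨i, rfl | rfl | rfl⟩ := hv v
  exacts [⟨_, linkEndsAt_earedAntiprism_base i⟩, ⟨_, linkEndsAt_earedAntiprism_ear i⟩,
    ⟨_, linkEndsAt_earedAntiprism_top i⟩]

theorem connected_earedAntiprism : earedAntiprism.Connected := by
  rw [connected_iff_exists_forall_reachable]
  have hbase : ∀ i, earedAntiprism.Reachable 0 (baseVertex i) := by
    have h01 : earedAntiprism.Reachable 0 1 := Adj.reachable (by decide)
    have h12 : earedAntiprism.Reachable 1 2 := Adj.reachable (by decide)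
    have h03 : earedAntiprism.Reachable 0 3 := Adj.reachable (by decide)
    intro i
    fin_cases i
    exacts [.rfl, h01, h01.trans h12, h03]
  have hadj : ∀ v, ∃ i, earedAntiprism.Adj (baseVertex i) v := by decide
  refine ⟨0, fun v => ?_⟩
  obtain ⟨i, hi⟩ := hadj v
  exact (hbase i).trans hi.reachable

theorem ncard_edgeSet_earedAntiprism : earedAntiprism.edgeSet.ncard = 24 := by
  have hdeg : ∑ v, earedAntiprism.degree v = 48 := by decide
  rw [sum_degrees_eq_twice_card_edges] at hdeg
  rw [← coe_edgeFinset, Set.ncard_coe_finset]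
  omega

end EaredAntiprism

/-- The invariant preserved by gluing triangles to the top of the eared antiprism: the edge `xy`
lies in one triangle only and the ears `w i` keep their neighbors. -/
theorem exists_linkEndsAt_chain (n : ℕ) (hn : 12 ≤ n) :
    ∃ (G : SimpleGraph (Fin n)) (x y : Fin n) (u w : Fin 4 → Fin n),
      G.Connected ∧ (∀ v, ∃ t, G.LinkEndsAt v t) ∧ G.edgeSet.ncard = 2 * n ∧
      G.Adj x y ∧ G.LinkEndsAt x y ∧ G.LinkEndsAt y x ∧ Function.Injective w ∧
      (∀ i, G.neighborSet (w i) ⊆ {u i, u (i + 1)}) ∧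
      x ∉ Set.range u ∪ Set.range w ∧ y ∉ Set.range w := by
  induction n, hn using Nat.le_induction with
  | base =>
    refine ⟨earedAntiprism, topVertex 0, topVertex 1, baseVertex, earVertex,
      connected_earedAntiprism, exists_linkEndsAt_earedAntiprism, ncard_edgeSet_earedAntiprism,
      by decide, linkEndsAt_earedAntiprism_top 0, linkEndsAt_earedAntiprism_top_sub 1,
      by decide, ?_, ?_, ?_⟩
    · have h : ∀ i z, earedAntiprism.Adj (earVertex i) z →
          z = baseVertex i ∨ z = baseVertex (i + 1) := by decide
      exact h
    · simp only [Set.mem_union, Set.mem_range]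
      decide
    · simp only [Set.mem_range]
      decide
  | succ n hn ih =>
    obtain ⟨G, x, y, u, w, hconn, hlink, hcard, hxy, hx, hy, hw, hN, hxuw, hyw⟩ := ih
    simp only [Set.mem_union, Set.mem_range, not_or, not_exists] at hxuw hyw
    refine ⟨G.addEar x y, x.castSucc, Fin.last n, Fin.castSucc ∘ u, Fin.castSucc ∘ w,
      hconn.addEar, exists_linkEndsAt_addEar hxy hx hy hlink, ?_, by simp,
      linkEndsAt_addEar_left hx, linkEndsAt_addEar_last hxy,
      (Fin.castSucc_injective n).comp hw, fun i => ?_, ?_, ?_⟩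
    · rw [ncard_edgeSet_addEar hxy.ne, hcard]
      ring
    · simp only [Function.comp_apply]
      rw [neighborSet_addEar_castSucc_of_ne (hxuw.2 i) (hyw i), ← Set.image_pair]
      exact Set.image_mono (hN i)
    · simpa using hxuw
    · simp

end SimpleGraph

/-- For every `n ≥ 12` there is a nonhamiltonian locally linear graph with
exactly `n` vertices and `2n` edges. -/
theorem stmt_11 (n : ℕ) (hn : 12 ≤ n) :
    ∃ G : SimpleGraph (Fin n), G.Connected ∧ LocallyPath G ∧ ¬ G.IsHamiltonian ∧
      G.edgeSet.ncard = 2 * n := by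
  obtain ⟨G, x, y, u, w, hconn, hlink, hcard, -, -, -, hw, hN, hx, -⟩ :=
    SimpleGraph.exists_linkEndsAt_chain n hn
  refine ⟨G, hconn, SimpleGraph.locallyPath_of_linkEndsAt hlink, fun hham => ?_, hcard⟩
  obtain ⟨a, p, hp⟩ := hham (by rw [Fintype.card_fin]; omega)
  exact hx (hp.mem_range_of_neighborSet_subset_pair (Equiv.addRight 1) (by simp) hw hN x)
end

section
/- Every nontraceable locally linear graph on n vertices has at least 2n+3 edges. -/
/-- A graph is traceable if it has a Hamilton path. -/
def Traceable {V : Type*} [DecidableEq V] (G : SimpleGraph V) : Prop :=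
  ∃ (u v : V) (p : G.Walk u v), p.IsHamiltonian

/-- A matrix whose kernel consists of constant vectors has corank
at most one. -/
lemma Matrix.card_le_rank_add_one_of_ker_const {m n K : Type*} [Fintype m] [Fintype n] [Field K]
    (N : Matrix m n K) (h : ∀ x, N.mulVec x = 0 → ∃ c, ∀ i, x i = c) :
    Fintype.card n ≤ N.rank + 1 := by
  have hker : LinearMap.ker N.mulVecLin ≤ Submodule.span K {fun _ => (1 : K)} := by
    intro x hx
    obtain ⟨c, hc⟩ := h x (by simpa using hx)
    rw [Submodule.mem_span_singleton]
    exact ⟨c, by ext i; simp [hc]⟩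
  have h1 := LinearMap.finrank_range_add_finrank_ker N.mulVecLin
  have h2 := (Submodule.finrank_mono hker).trans (finrank_span_le_card (R := K) _)
  rw [Module.finrank_fintype_fun_eq_card] at h1
  rw [Set.toFinset_card, Fintype.card_unique] at h2
  rw [Matrix.rank]
  omega

namespace SimpleGraph

variable {V : Type*} (G : SimpleGraph V)

/-- The neighborhood of `v` is the path `p 0, p 1, …, p k`. -/
structure IsLink (v : V) (k : ℕ) (p : ℕ → V) : Prop where
  inj : ∀ i ≤ k, ∀ j ≤ k, p i = p j → i = j
  mem : ∀ u, G.Adj v u ↔ ∃ i ≤ k, p i = u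
  adj : ∀ i ≤ k, ∀ j ≤ k, G.Adj (p i) (p j) ↔ i + 1 = j ∨ j + 1 = i

/-- The edges lying in exactly one triangle. -/
def boundaryGraph : SimpleGraph V where
  Adj u v := G.Adj u v ∧ (G.commonNeighbors u v).ncard = 1
  symm := ⟨fun u v h => ⟨h.1.symm, by rw [commonNeighbors_symm]; exact h.2⟩⟩
  loopless := ⟨fun _ h => h.1.ne rfl⟩

lemma boundaryGraph_le : G.boundaryGraph ≤ G := fun _ _ h => h.1

variable {G}

lemma _root_.LocallyPath.exists_isLink (hG : LocallyPath G) (v : V) : ∃ k p, G.IsLink v k p := by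
  obtain ⟨k, ⟨φ⟩⟩ := hG v
  let p : ℕ → V := fun i => if h : i < k + 1 then (φ.symm ⟨i, h⟩ : G.neighborSet v) else v
  have hp : ∀ i (h : i ≤ k), p i = (φ.symm ⟨i, by omega⟩ : G.neighborSet v) :=
    fun i h => dif_pos (Nat.lt_succ_of_le h)
  refine ⟨k, p, ?_, ?_, ?_⟩
  · intro i hi j hj h
    rw [hp i hi, hp j hj] at h
    simpa using φ.symm.injective (Subtype.ext h)
  · intro u
    constructor
    · intro h
      refine ⟨φ ⟨u, h⟩, by have := (φ ⟨u, h⟩).2; omega, ?_⟩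
      rw [hp _ (by have := (φ ⟨u, h⟩).2; omega)]
      simp
    · rintro ⟨i, hi, rfl⟩
      rw [hp i hi]
      exact (φ.symm ⟨i, by omega⟩ : G.neighborSet v).2
  · intro i hi j hj
    rw [hp i hi, hp j hj]
    have := φ.symm.map_adj_iff (v := ⟨i, by omega⟩) (w := ⟨j, by omega⟩)
    rw [pathGraph_adj] at this
    simpa using this

namespace IsLink

variable {v : V} {k : ℕ} {p : ℕ → V}

lemma adj_apply (h : G.IsLink v k p) {i : ℕ} (hi : i ≤ k) : G.Adj v (p i) :=
  (h.mem _).2 ⟨i, hi, rfl⟩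

lemma mem_commonNeighbors (h : G.IsLink v k p) {i : ℕ} (hi : i ≤ k) (w : V) :
    w ∈ G.commonNeighbors v (p i) ↔ ∃ j ≤ k, p j = w ∧ (i + 1 = j ∨ j + 1 = i) := by
  rw [G.mem_commonNeighbors, h.mem]
  constructor
  · rintro ⟨⟨j, hj, rfl⟩, ha⟩
    exact ⟨j, hj, rfl, (h.adj i hi j hj).1 ha⟩
  · rintro ⟨j, hj, rfl, ha⟩
    exact ⟨⟨j, hj, rfl⟩, (h.adj i hi j hj).2 ha⟩

lemma commonNeighbors_zero (h : G.IsLink v k p) (hk : 1 ≤ k) :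
    G.commonNeighbors v (p 0) = {p 1} := by
  ext w
  rw [h.mem_commonNeighbors (by omega)]
  constructor
  · rintro ⟨j, hj, rfl, hj'⟩
    obtain rfl : j = 1 := by omega
    rfl
  · rintro rfl
    exact ⟨1, hk, rfl, by omega⟩

lemma commonNeighbors_last (h : G.IsLink v k p) (hk : 1 ≤ k) :
    G.commonNeighbors v (p k) = {p (k - 1)} := by
  ext w
  rw [h.mem_commonNeighbors le_rfl]
  constructor
  · rintro ⟨j, hj, rfl, hj'⟩
    obtain rfl : j = k - 1 := by omega
    rfl
  · rintro rfl
    exact ⟨k - 1, by omega, rfl, by omega⟩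

lemma commonNeighbors_succ (h : G.IsLink v k p) {i : ℕ} (hi : i + 2 ≤ k) :
    G.commonNeighbors v (p (i + 1)) = {p i, p (i + 2)} := by
  ext w
  rw [h.mem_commonNeighbors (by omega)]
  constructor
  · rintro ⟨j, hj, rfl, hj'⟩
    obtain rfl | rfl : j = i ∨ j = i + 2 := by omega
    · exact Or.inl rfl
    · exact Or.inr rfl
  · rintro (rfl | rfl)
    · exact ⟨i, by omega, rfl, by omega⟩
    · exact ⟨i + 2, by omega, rfl, by omega⟩

lemma ncard_commonNeighbors_succ (h : G.IsLink v k p) {i : ℕ} (hi : i + 2 ≤ k) :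
    (G.commonNeighbors v (p (i + 1))).ncard = 2 := by
  rw [h.commonNeighbors_succ hi]
  refine Set.ncard_pair fun he => ?_
  have := h.inj _ (by omega) _ (by omega) he
  omega

lemma ncard_commonNeighbors_eq_one_or_two (h : G.IsLink v k p) (hk : 1 ≤ k) {u : V}
    (hu : G.Adj v u) :
    (G.commonNeighbors v u).ncard = 1 ∨ (G.commonNeighbors v u).ncard = 2 := by
  obtain ⟨i, hi, rfl⟩ := (h.mem u).1 hu
  rcases Nat.eq_zero_or_pos i with rfl | hi0
  · left; rw [h.commonNeighbors_zero hk, Set.ncard_singleton]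
  rcases hi.eq_or_lt with rfl | hik
  · left; rw [h.commonNeighbors_last hk, Set.ncard_singleton]
  obtain ⟨i, rfl⟩ := Nat.exists_eq_succ_of_ne_zero hi0.ne'
  exact Or.inr (h.ncard_commonNeighbors_succ (by omega))

lemma neighborSet_boundaryGraph (h : G.IsLink v k p) (hk : 1 ≤ k) :
    G.boundaryGraph.neighborSet v = {p 0, p k} := by
  ext u
  constructor
  · rintro ⟨hu, h1⟩
    obtain ⟨i, hi, rfl⟩ := (h.mem u).1 hu
    rcases Nat.eq_zero_or_pos i with rfl | hi0
    · exact Or.inl rfl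
    rcases hi.eq_or_lt with rfl | hik
    · exact Or.inr rfl
    obtain ⟨i, rfl⟩ := Nat.exists_eq_succ_of_ne_zero hi0.ne'
    have := h.ncard_commonNeighbors_succ (i := i) (by omega)
    simp only [Nat.succ_eq_add_one] at h1
    omega
  · rintro (rfl | rfl)
    · exact ⟨h.adj_apply (by omega), by rw [h.commonNeighbors_zero hk, Set.ncard_singleton]⟩
    · exact ⟨h.adj_apply le_rfl, by rw [h.commonNeighbors_last hk, Set.ncard_singleton]⟩

lemma ncard_neighborSet_boundaryGraph (h : G.IsLink v k p) (hk : 1 ≤ k) :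
    (G.boundaryGraph.neighborSet v).ncard = 2 := by
  rw [h.neighborSet_boundaryGraph hk]
  refine Set.ncard_pair fun he => ?_
  have := h.inj _ (by omega) _ le_rfl he
  omega

/-- In a connected nontraceable locally linear graph every link has at least two vertices. -/
lemma one_le_of_not_traceable [DecidableEq V] (h : G.IsLink v k p) (hconn : G.Connected)
    (hG : LocallyPath G) (hnt : ¬ Traceable G) : 1 ≤ k := by
  by_contra hk
  obtain rfl : k = 0 := by omega
  apply hnt
  have hv : ∀ w, G.Adj v w → w = p 0 := by
    intro w hw
    obtain ⟨i, hi, rfl⟩ := (h.mem w).1 hw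
    rw [Nat.le_zero.1 hi]
  have hvu : G.Adj v (p 0) := h.adj_apply le_rfl
  obtain ⟨l, q, hq⟩ := hG.exists_isLink (p 0)
  have hl : l = 0 := by
    by_contra hl
    obtain ⟨i, hi, hiv⟩ := (hq.mem v).1 hvu.symm
    obtain ⟨j, hj, hij⟩ : ∃ j ≤ l, i + 1 = j ∨ j + 1 = i := by
      by_cases hi0 : i = 0
      · exact ⟨1, by omega, by omega⟩
      · exact ⟨i - 1, by omega, by omega⟩
    have ha := (hq.adj i hi j hj).2 hij
    rw [hiv] at ha
    exact (hq.adj_apply hj).ne (hv _ ha).symm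
  subst hl
  have hu : ∀ w, G.Adj (p 0) w → w = v := by
    intro w hw
    obtain ⟨i, hi, rfl⟩ := (hq.mem w).1 hw
    obtain ⟨j, hj, rfl⟩ := (hq.mem v).1 hvu.symm
    rw [Nat.le_zero.1 hi, Nat.le_zero.1 hj]
  have hall : ∀ w, w = v ∨ w = p 0 := by
    intro w
    obtain ⟨r⟩ := hconn.preconnected v w
    by_contra hw
    obtain ⟨d, -, hd1, hd2⟩ := r.exists_boundary_dart {v, p 0} (Or.inl rfl) hw
    rcases hd1 with hd1 | hd1
    · exact hd2 (Or.inr (hv _ (hd1 ▸ d.adj)))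
    · rw [Set.mem_singleton_iff] at hd1
      exact hd2 (Or.inl (hu _ (hd1 ▸ d.adj)))
  refine ⟨v, p 0, hvu.toWalk, Walk.IsPath.isHamiltonian_of_mem ?_ ?_⟩
  · exact Walk.IsPath.of_adj hvu
  · intro w
    simpa using hall w

end IsLink

/-- In a graph all of whose degrees are two, each component has a Hamilton path ending at any
prescribed vertex. -/
lemma exists_isPath_mem_support_iff_reachable [Finite V]
    (hG : ∀ v, (G.neighborSet v).ncard = 2) (v : V) :
    ∃ u, ∃ q : G.Walk u v, q.IsPath ∧ ∀ w, w ∈ q.support ↔ G.Reachable v w := by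
  have hc : G.IsCycles := fun w _ => hG w
  obtain ⟨p, hp, hs⟩ := hc.exists_cycle_toSubgraph_verts_eq_connectedComponentSupp
    (c := G.connectedComponentMk v) (v := v) rfl
    (Set.nonempty_of_ncard_ne_zero (by rw [hG]; decide))
  refine ⟨_, p.tail, hp.isPath_tail, fun w => ?_⟩
  have : w ∈ p.tail.support ↔ w ∈ p.support := by
    rw [p.support_tail_of_not_nil hp.not_nil]
    refine ⟨List.mem_of_mem_tail, fun hw => ?_⟩
    rw [← p.cons_tail_support, List.mem_cons] at hw
    rcases hw with rfl | hw
    · exact p.end_mem_tail_support hp.not_nil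
    · exact hw
  rw [this, ← Walk.mem_verts_toSubgraph, hs, ConnectedComponent.mem_supp_iff,
    ConnectedComponent.eq, reachable_comm]

/-- A connected nontraceable graph has at least three components in any spanning 2-factor. -/
lemma three_le_card_connectedComponent [Fintype V] [DecidableEq V] (hconn : G.Connected)
    (hnt : ¬ Traceable G) {B : SimpleGraph V} (hB : B ≤ G)
    (h2 : ∀ v, (B.neighborSet v).ncard = 2) : 3 ≤ Nat.card B.ConnectedComponent := by
  obtain ⟨v₀⟩ := hconn.nonempty
  have h1 : ∃ w, ¬ B.Reachable v₀ w := by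
    by_contra! h
    obtain ⟨u, q, hq, hs⟩ := exists_isPath_mem_support_iff_reachable h2 v₀
    refine hnt ⟨u, v₀, q.mapLe hB, Walk.IsPath.isHamiltonian_of_mem (hq.mapLe hB) fun w => ?_⟩
    simpa using (hs w).2 (h w)
  obtain ⟨w₀, hw₀⟩ := h1
  obtain ⟨r⟩ := hconn.preconnected v₀ w₀
  obtain ⟨d, -, hd1, hd2⟩ := r.exists_boundary_dart {w | B.Reachable v₀ w} (Reachable.refl _) hw₀
  obtain ⟨⟨x, y⟩, hxy⟩ := d
  simp only [Set.mem_ofPred_eq] at hd1 hd2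
  have hnxy : ¬ B.Reachable x y := fun h => hd2 (hd1.trans h)
  have h3 : ∃ z, ¬ B.Reachable x z ∧ ¬ B.Reachable y z := by
    by_contra! h
    obtain ⟨a, q, hq, hs⟩ := exists_isPath_mem_support_iff_reachable h2 x
    obtain ⟨b, t, ht, hs'⟩ := exists_isPath_mem_support_iff_reachable h2 y
    refine hnt ⟨a, b, (q.mapLe hB).append (.cons hxy (t.mapLe hB).reverse),
      Walk.IsPath.isHamiltonian_of_mem ?_ fun w => ?_⟩
    · rw [Walk.isPath_def, Walk.support_append, Walk.support_cons, List.tail_cons,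
        List.nodup_append', Walk.support_reverse, List.nodup_reverse]
      refine ⟨(hq.mapLe hB).support_nodup, (ht.mapLe hB).support_nodup, fun w hw hw' => ?_⟩
      rw [List.mem_reverse] at hw'
      rw [Walk.support_mapLe_eq_support] at hw hw'
      exact hnxy (((hs w).1 hw).trans ((hs' w).1 hw').symm)
    · rw [Walk.support_append, Walk.support_cons, List.tail_cons, List.mem_append,
        Walk.support_reverse, List.mem_reverse, Walk.support_mapLe_eq_support,
        Walk.support_mapLe_eq_support, hs, hs']
      by_cases hw : B.Reachable x w
      · exact Or.inl hw
      · exact Or.inr (h w hw)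
  obtain ⟨z, hz1, hz2⟩ := h3
  have hcard : ({B.connectedComponentMk x, B.connectedComponentMk y,
      B.connectedComponentMk z} : Set B.ConnectedComponent).ncard = 3 := by
    rw [Set.ncard_eq_three]
    refine ⟨_, _, _, ?_, ?_, ?_, rfl⟩ <;> rwa [Ne, ConnectedComponent.eq]
  rw [← hcard]
  exact Set.ncard_le_card _

section Counting

open Finset

lemma IsNClique.card_filter_adj_eq_two [Fintype V] [DecidableEq V] [DecidableRel G.Adj]
    {s : Finset V} (hs : G.IsNClique 3 s) {v : V} (hv : v ∈ s) :
    #{u ∈ G.neighborFinset v | u ∈ s} = 2 := by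
  have : {u ∈ G.neighborFinset v | u ∈ s} = s.erase v := by
    ext u
    simp only [mem_filter, mem_neighborFinset, mem_erase]
    exact ⟨fun h => ⟨h.1.ne', h.2⟩, fun h => ⟨hs.isClique hv h.2 h.1.symm, h.2⟩⟩
  rw [this, card_erase_of_mem hv, hs.card_eq]

variable [Fintype V] [DecidableEq V] [DecidableRel G.Adj]

/-- The triangles on an edge correspond to the common neighbors of its ends. -/
lemma sum_cliqueFinset_filter_edge {M : Type*} [AddCommMonoid M] {u v : V} (huv : G.Adj u v)
    (f : Finset V → M) :
    ∑ s ∈ G.cliqueFinset 3 with u ∈ s ∧ v ∈ s, f s =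
      ∑ w ∈ (G.commonNeighbors u v).toFinset, f {u, v, w} := by
  have himg : {s ∈ G.cliqueFinset 3 | u ∈ s ∧ v ∈ s} =
      (G.commonNeighbors u v).toFinset.image fun w => {u, v, w} := by
    ext s
    simp only [mem_filter, mem_cliqueFinset_iff, mem_image, Set.mem_toFinset,
      mem_commonNeighbors]
    constructor
    · rintro ⟨hs, hu, hv⟩
      obtain ⟨w, hw⟩ : ∃ w, (s.erase u).erase v = {w} := by
        rw [← card_eq_one, card_erase_of_mem (mem_erase.2 ⟨huv.ne', hv⟩), card_erase_of_mem hu,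
          hs.card_eq]
      have hw' : w ∈ (s.erase u).erase v := by rw [hw]; exact mem_singleton_self w
      simp only [mem_erase] at hw'
      refine ⟨w, ⟨hs.isClique hu hw'.2.2 hw'.2.1.symm, hs.isClique hv hw'.2.2 hw'.1.symm⟩, ?_⟩
      rw [← hw, insert_erase (mem_erase.2 ⟨huv.ne', hv⟩), insert_erase hu]
    · rintro ⟨w, ⟨huw, hvw⟩, rfl⟩
      exact ⟨is3Clique_triple_iff.2 ⟨huv, huw, hvw⟩, by simp, by simp⟩
  rw [himg, sum_image]
  intro w hw w' hw' h
  simp only [Set.coe_toFinset, mem_commonNeighbors] at hw hw'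
  have : w ∈ ({u, v, w'} : Finset V) := by
    rw [← show ({u, v, w} : Finset V) = {u, v, w'} from h]; simp
  simp only [mem_insert, mem_singleton] at this
  rcases this with h | h | h
  · exact absurd h hw.1.ne'
  · exact absurd h hw.2.ne'
  · exact h

lemma card_cliqueFinset_filter_edge {u v : V} (huv : G.Adj u v) :
    #{s ∈ G.cliqueFinset 3 | u ∈ s ∧ v ∈ s} = (G.commonNeighbors u v).ncard := by
  rw [card_eq_sum_ones, sum_cliqueFinset_filter_edge huv, ← card_eq_sum_ones,
    Set.ncard_eq_toFinset_card']

lemma sum_edgeFinset_mul_mem {R : Type*} [Semiring R] (g : Sym2 V → R) (v : V) :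
    ∑ e ∈ G.edgeFinset, g e * (if v ∈ e then 1 else 0) = ∑ u ∈ G.neighborFinset v, g s(v, u) := by
  have himg : {e ∈ G.edgeFinset | v ∈ e} = (G.neighborFinset v).image fun u => s(v, u) := by
    ext e
    induction e with | _ a b
    simp only [mem_filter, mem_edgeFinset, mem_edgeSet, Sym2.mem_iff, mem_image,
      mem_neighborFinset]
    constructor
    · rintro ⟨h, rfl | rfl⟩
      · exact ⟨b, h, rfl⟩
      · exact ⟨a, h.symm, Sym2.eq_swap⟩
    · rintro ⟨u, hu, h⟩
      rw [Sym2.eq_iff] at h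
      rcases h with ⟨rfl, rfl⟩ | ⟨rfl, rfl⟩
      · exact ⟨hu, Or.inl rfl⟩
      · exact ⟨hu.symm, Or.inr rfl⟩
  simp only [mul_ite, mul_one, mul_zero]
  rw [← sum_filter, himg, sum_image]
  intro a _ b _ h
  exact Sym2.congr_right.1 h

/-- Double counting of the incidences between edges and triangles. -/
lemma three_mul_card_cliqueFinset_add_card
    (h12 : ∀ u v, G.Adj u v →
      (G.commonNeighbors u v).ncard = 1 ∨ (G.commonNeighbors u v).ncard = 2)
    (h2 : ∀ v, (G.boundaryGraph.neighborSet v).ncard = 2) :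
    3 * #(G.cliqueFinset 3) + Fintype.card V = 2 * #G.edgeFinset := by
  classical
  have hcount : ∑ v, ∑ u ∈ G.neighborFinset v, (G.commonNeighbors v u).ncard =
      6 * #(G.cliqueFinset 3) := by
    calc
      _ = ∑ v, ∑ u ∈ G.neighborFinset v, ∑ s ∈ G.cliqueFinset 3,
            if v ∈ s ∧ u ∈ s then 1 else 0 := by
        refine sum_congr rfl fun v _ => sum_congr rfl fun u hu => ?_
        rw [← card_cliqueFinset_filter_edge ((G.mem_neighborFinset _ _).1 hu), card_filter]
      _ = ∑ v, ∑ s ∈ G.cliqueFinset 3, if v ∈ s then 2 else 0 := by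
        refine sum_congr rfl fun v _ => ?_
        rw [sum_comm]
        refine sum_congr rfl fun s hs => ?_
        split_ifs with hv
        · simp only [hv, true_and]
          rw [← card_filter, ((G.mem_cliqueFinset_iff).1 hs).card_filter_adj_eq_two hv]
        · simp [hv]
      _ = ∑ s ∈ G.cliqueFinset 3, 6 := by
        rw [sum_comm]
        refine sum_congr rfl fun s hs => ?_
        rw [← sum_filter, filter_mem_eq_inter, univ_inter, sum_const,
          ((G.mem_cliqueFinset_iff).1 hs).card_eq]
        rfl
      _ = 6 * #(G.cliqueFinset 3) := by rw [sum_const, smul_eq_mul, mul_comm]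
  have hlocal : ∀ v, ∑ u ∈ G.neighborFinset v, (G.commonNeighbors v u).ncard + 2 =
      2 * G.degree v := by
    intro v
    have hB : #{u ∈ G.neighborFinset v | (G.commonNeighbors v u).ncard = 1} = 2 := by
      rw [← h2 v, Set.ncard_eq_toFinset_card']
      congr 1
      ext u
      simp [boundaryGraph]
    have hsum : ∑ u ∈ G.neighborFinset v, ((G.commonNeighbors v u).ncard +
        if (G.commonNeighbors v u).ncard = 1 then 1 else 0) = ∑ u ∈ G.neighborFinset v, 2 := by
      refine sum_congr rfl fun u hu => ?_
      rcases h12 v u ((G.mem_neighborFinset _ _).1 hu) with h | h <;> rw [h] <;> rfl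
    rw [sum_add_distrib, ← card_filter, hB, sum_const, card_neighborFinset_eq_degree,
      smul_eq_mul] at hsum
    rw [hsum, mul_comm]
  have hsum := sum_congr (rfl : (univ : Finset V) = univ) fun v _ => hlocal v
  rw [sum_add_distrib, hcount, ← mul_sum, G.sum_degrees_eq_twice_card_edges, sum_const,
    card_univ, smul_eq_mul] at hsum
  omega

end Counting

lemma Preconnected.apply_eq_of_forall_adj {α : Type*} (hG : G.Preconnected) {g : V → α}
    (h : ∀ u v, G.Adj u v → g u = g v) (u v : V) : g u = g v := by
  obtain ⟨r⟩ := hG u v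
  induction r with
  | nil => rfl
  | cons ha _ ih => exact (h _ _ ha).trans ih

lemma IsLink.apply_triangle_eq [DecidableEq V] {α : Type*} {f : Finset V → α}
    (hf : ∀ u v a b, G.Adj u v → a ≠ b → G.commonNeighbors u v = {a, b} →
      f {u, v, a} = f {u, v, b})
    {v : V} {k : ℕ} {p : ℕ → V} (h : G.IsLink v k p) {i : ℕ} (hi : i + 1 ≤ k) :
    f {v, p i, p (i + 1)} = f {v, p 0, p 1} := by
  induction i with
  | zero => rfl
  | succ i ih =>
    rw [← ih (by omega), ← hf v (p (i + 1)) (p i) (p (i + 2)) (h.adj_apply (by omega)) ?_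
      (h.commonNeighbors_succ hi), Finset.pair_comm]
    intro he
    have := h.inj _ (by omega) _ (by omega) he
    omega

/-- A function on triangles that agrees on triangles sharing an interior edge is constant. -/
lemma exists_forall_is3Clique_eq [DecidableEq V] (hconn : G.Connected)
    (hlink : ∀ v, ∃ k p, 1 ≤ k ∧ G.IsLink v k p) {α : Type*} {f : Finset V → α}
    (hf : ∀ u v a b, G.Adj u v → a ≠ b → G.commonNeighbors u v = {a, b} →
      f {u, v, a} = f {u, v, b}) :
    ∃ c, ∀ s, G.IsNClique 3 s → f s = c := by
  choose k p hk hp using hlink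
  have hloc : ∀ v a b, G.Adj v a → G.Adj v b → G.Adj a b →
      f {v, a, b} = f {v, p v 0, p v 1} := by
    intro v a b ha hb hab
    obtain ⟨i, hi, rfl⟩ := ((hp v).mem a).1 ha
    obtain ⟨j, hj, rfl⟩ := ((hp v).mem b).1 hb
    rcases ((hp v).adj i hi j hj).1 hab with rfl | rfl
    · exact (hp v).apply_triangle_eq hf hj
    · rw [Finset.pair_comm]
      exact (hp v).apply_triangle_eq hf hi
  have hadj : ∀ u v, G.Adj u v → f {u, p u 0, p u 1} = f {v, p v 0, p v 1} := by
    intro u v huv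
    obtain ⟨i, hi, rfl⟩ := ((hp u).mem v).1 huv
    obtain ⟨j, hj, hij⟩ : ∃ j ≤ k u, i + 1 = j ∨ j + 1 = i := by
      have := hk u
      by_cases hi0 : i = 0
      · exact ⟨1, by omega, by omega⟩
      · exact ⟨i - 1, by omega, by omega⟩
    have ha := ((hp u).adj i hi j hj).2 hij
    rw [← hloc u _ _ huv ((hp u).adj_apply hj) ha, ← hloc _ _ _ huv.symm ha ((hp u).adj_apply hj),
      Finset.insert_comm]
  obtain ⟨v₀⟩ := hconn.nonempty
  refine ⟨f {v₀, p v₀ 0, p v₀ 1}, fun s hs => ?_⟩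
  obtain ⟨a, b, c, hab, hac, hbc, rfl⟩ := is3Clique_iff.1 hs
  rw [hloc a b c hab hac hbc]
  exact hconn.preconnected.apply_eq_of_forall_adj hadj a v₀

section Homology

open Finset

variable (G) in
/-- The incidence matrix over the two-element field of the faces of the closed surface obtained
from `G` by capping every boundary component with a disc. -/
def faceMatrix [Fintype V] [DecidableEq V] [DecidableRel G.Adj]
    [DecidableRel G.boundaryGraph.Adj] [DecidableEq G.boundaryGraph.ConnectedComponent] :
    Matrix (↥(G.cliqueFinset 3) ⊕ G.boundaryGraph.ConnectedComponent) ↥G.edgeFinset (ZMod 2) :=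
  fun f e => match f with
    | .inl s => if ∀ w ∈ e.1, w ∈ s.1 then 1 else 0
    | .inr c => if e.1 ∈ G.boundaryGraph.edgeSet ∧
        ∀ w ∈ e.1, G.boundaryGraph.connectedComponentMk w = c then 1 else 0

variable (G) in
/-- The incidence matrix of edges and vertices over the two-element field. -/
def edgeMatrix [Fintype V] [DecidableEq V] [DecidableRel G.Adj] :
    Matrix ↥G.edgeFinset V (ZMod 2) :=
  fun e v => if v ∈ e.1 then 1 else 0

variable [Fintype V] [DecidableEq V] [DecidableRel G.Adj]

lemma exists_eq_const_of_edgeMatrix_mulVec_eq_zero (hconn : G.Connected) (x : V → ZMod 2)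
    (hx : G.edgeMatrix.mulVec x = 0) : ∃ c, ∀ v, x v = c := by
  obtain ⟨v₀⟩ := hconn.nonempty
  refine ⟨x v₀, fun v => hconn.preconnected.apply_eq_of_forall_adj (fun u v huv => ?_) v v₀⟩
  have h := congr_fun hx ⟨s(u, v), by simpa using huv⟩
  have hf : ({w | w = u ∨ w = v} : Finset V) = {u, v} := by ext; simp
  simp only [Matrix.mulVec, dotProduct, edgeMatrix, Sym2.mem_iff, ite_mul, one_mul, zero_mul,
    Pi.zero_apply] at h
  rw [← sum_filter, hf, sum_pair huv.ne] at h
  exact CharTwo.add_eq_zero.1 h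

variable [DecidableRel G.boundaryGraph.Adj] [DecidableEq G.boundaryGraph.ConnectedComponent]

lemma faceMatrix_mul_edgeMatrix (h2 : ∀ v, (G.boundaryGraph.neighborSet v).ncard = 2) :
    G.faceMatrix * G.edgeMatrix = 0 := by
  ext f v
  rw [Matrix.mul_apply, Matrix.zero_apply]
  rcases f with ⟨s, hs⟩ | c
  · simp only [faceMatrix, edgeMatrix]
    rw [sum_coe_sort G.edgeFinset fun e => (if ∀ w ∈ e, w ∈ s then (1 : ZMod 2) else 0) *
      if v ∈ e then 1 else 0, sum_edgeFinset_mul_mem]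
    simp only [Sym2.mem_iff, forall_eq_or_imp, forall_eq]
    by_cases hv : v ∈ s
    · simp only [hv, true_and]
      rw [sum_boole, ((G.mem_cliqueFinset_iff).1 hs).card_filter_adj_eq_two hv]
      rfl
    · simp [hv]
  · simp only [faceMatrix, edgeMatrix]
    rw [sum_coe_sort G.edgeFinset fun e => (if e ∈ G.boundaryGraph.edgeSet ∧
      ∀ w ∈ e, G.boundaryGraph.connectedComponentMk w = c then (1 : ZMod 2) else 0) *
      if v ∈ e then 1 else 0, sum_edgeFinset_mul_mem]
    simp only [Sym2.mem_iff, forall_eq_or_imp, forall_eq, mem_edgeSet]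
    by_cases hv : G.boundaryGraph.connectedComponentMk v = c
    · have hB : {u ∈ G.neighborFinset v | G.boundaryGraph.Adj v u ∧
          G.boundaryGraph.connectedComponentMk v = c ∧
          G.boundaryGraph.connectedComponentMk u = c} = (G.boundaryGraph.neighborSet v).toFinset := by
        ext u
        simp only [mem_filter, mem_neighborFinset, Set.mem_toFinset, mem_neighborSet]
        refine ⟨fun h => h.2.1, fun h => ⟨h.1, h, hv, ?_⟩⟩
        rw [← hv, ConnectedComponent.eq]
        exact h.symm.reachable
      rw [sum_boole, hB, ← Set.ncard_eq_toFinset_card', h2]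
      rfl
    · simp [hv]

lemma exists_eq_const_of_faceMatrix_transpose_mulVec_eq_zero
    [Fintype G.boundaryGraph.ConnectedComponent] (hconn : G.Connected)
    (hlink : ∀ v, ∃ k p, 1 ≤ k ∧ G.IsLink v k p)
    (x : ↥(G.cliqueFinset 3) ⊕ G.boundaryGraph.ConnectedComponent → ZMod 2)
    (hx : G.faceMatrix.transpose.mulVec x = 0) : ∃ c, ∀ f, x f = c := by
  let t : Finset V → ZMod 2 := fun s => if h : s ∈ G.cliqueFinset 3 then x (.inl ⟨s, h⟩) else 0
  have ht : ∀ s (h : s ∈ G.cliqueFinset 3), x (.inl ⟨s, h⟩) = t s := fun s h => by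
    simp only [t, dif_pos h]
  have key : ∀ u v, G.Adj u v → (∑ w ∈ (G.commonNeighbors u v).toFinset, t {u, v, w}) +
      (if G.boundaryGraph.Adj u v then x (.inr (G.boundaryGraph.connectedComponentMk u)) else 0)
      = 0 := by
    intro u v huv
    refine Eq.trans ?_ (congr_fun hx ⟨s(u, v), by simpa using huv⟩)
    rw [Matrix.mulVec, dotProduct, Fintype.sum_sum_type]
    congr 1
    · rw [← sum_cliqueFinset_filter_edge huv, sum_filter, ← sum_coe_sort]
      refine sum_congr rfl fun s _ => ?_
      simp only [Matrix.transpose_apply, faceMatrix, Sym2.mem_iff, forall_eq_or_imp, forall_eq,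
        ite_mul, one_mul, zero_mul]
      rw [ht s.1 s.2]
    · simp only [Matrix.transpose_apply, faceMatrix, Sym2.mem_iff, forall_eq_or_imp, forall_eq,
        ite_mul, one_mul, zero_mul, mem_edgeSet]
      by_cases hb : G.boundaryGraph.Adj u v
      · have : G.boundaryGraph.connectedComponentMk v = G.boundaryGraph.connectedComponentMk u := by
          rw [ConnectedComponent.eq]
          exact hb.symm.reachable
        simp [hb, this]
      · simp [hb]
  obtain ⟨c, hc⟩ := exists_forall_is3Clique_eq hconn hlink (f := t) (by
    intro u v a b huv hab h
    have hk := key u v huv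
    have hb : ¬ G.boundaryGraph.Adj u v := by
      rintro ⟨-, h1⟩
      rw [h, Set.ncard_pair hab] at h1
      omega
    have hf : (G.commonNeighbors u v).toFinset = {a, b} := by
      ext w; simp [h]
    rw [if_neg hb, add_zero, hf, sum_pair hab] at hk
    exact CharTwo.add_eq_zero.1 hk)
  refine ⟨c, ?_⟩
  rintro (⟨s, hs⟩ | d)
  · rw [ht, hc s ((G.mem_cliqueFinset_iff).1 hs)]
  · induction d using ConnectedComponent.ind with | _ v
    obtain ⟨k, p, hk, hp⟩ := hlink v
    have hv0 := hp.adj_apply (Nat.zero_le k)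
    have h0 := hp.commonNeighbors_zero hk
    have hkey := key v (p 0) hv0
    have hf : (G.commonNeighbors v (p 0)).toFinset = {p 1} := by
      ext w; simp [h0]
    have hb : G.boundaryGraph.Adj v (p 0) := ⟨hv0, by rw [h0, Set.ncard_singleton]⟩
    rw [if_pos hb, hf, sum_singleton, hc _ (is3Clique_triple_iff.2 ⟨hv0, hp.adj_apply hk,
      (hp.adj 0 (by omega) 1 hk).2 (Or.inl rfl)⟩)] at hkey
    exact (CharTwo.add_eq_zero.1 hkey).symm

end Homology

end SimpleGraph

/-- Every nontraceable locally linear graph on `n` vertices has at least `2n + 3` edges. -/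
theorem stmt_12 {V : Type*} [Fintype V] [DecidableEq V] (G : SimpleGraph V)
    (hconn : G.Connected) (hG : LocallyPath G) (hnt : ¬ Traceable G) :
    2 * Fintype.card V + 3 ≤ G.edgeSet.ncard := by
  classical
  have hlink : ∀ v, ∃ k p, 1 ≤ k ∧ G.IsLink v k p := fun v => by
    obtain ⟨k, p, hp⟩ := hG.exists_isLink v
    exact ⟨k, p, hp.one_le_of_not_traceable hconn hG hnt, hp⟩
  have h12 : ∀ u v, G.Adj u v →
      (G.commonNeighbors u v).ncard = 1 ∨ (G.commonNeighbors u v).ncard = 2 := fun u v huv => by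
    obtain ⟨k, p, hk, hp⟩ := hlink u
    exact hp.ncard_commonNeighbors_eq_one_or_two hk huv
  have h2 : ∀ v, (G.boundaryGraph.neighborSet v).ncard = 2 := fun v => by
    obtain ⟨k, p, hk, hp⟩ := hlink v
    exact hp.ncard_neighborSet_boundaryGraph hk
  have hcomp := SimpleGraph.three_le_card_connectedComponent hconn hnt G.boundaryGraph_le h2
  have hcount := SimpleGraph.three_mul_card_cliqueFinset_add_card h12 h2
  have hE := G.edgeMatrix.card_le_rank_add_one_of_ker_const
    (SimpleGraph.exists_eq_const_of_edgeMatrix_mulVec_eq_zero hconn)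
  have hF := G.faceMatrix.transpose.card_le_rank_add_one_of_ker_const
    (SimpleGraph.exists_eq_const_of_faceMatrix_transpose_mulVec_eq_zero hconn hlink)
  have hEF := Matrix.rank_add_rank_le_card_of_mul_eq_zero
    (SimpleGraph.faceMatrix_mul_edgeMatrix h2)
  rw [Matrix.rank_transpose, Fintype.card_sum, Fintype.card_coe] at hF
  rw [Fintype.card_coe] at hEF
  rw [Nat.card_eq_fintype_card] at hcomp
  rw [Set.ncard_eq_toFinset_card']
  change _ ≤ G.edgeFinset.card
  omega
end

section
/- If G is a nonhamiltonian locally linear graph on n vertices with a vertex u of degree n−3, then the two vertices outside N[u] are nonadjacent to each other — in fact no such graph exists: any locally linear graph on n vertices with maximum degree n−3 is hamiltonian. -/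
namespace SimpleGraph.Walk

/-- An edge `s(a, b)` of a walk can be replaced by a detour from `a` to `b`
whose inner vertices are `M`. -/
theorem exists_detour {V : Type*} {G : SimpleGraph V} {a b : V} (r : G.Walk a b) (M : List V)
    (hr : r.support = a :: (M ++ [b])) {s t : V} (p : G.Walk s t) (hp : s(a, b) ∈ p.edges) :
    ∃ q : G.Walk s t, q.support.Perm (M ++ p.support) ∧
      ∀ e ∈ p.edges, e ≠ s(a, b) → e ∈ q.edges := by
  induction p with
  | nil => simp at hp
  | @cons c d t h p ih =>
    by_cases hcd : s(a, b) = s(c, d)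
    · obtain ⟨rfl, rfl⟩ | ⟨rfl, rfl⟩ := Sym2.eq_iff.1 hcd
      · refine ⟨r.append p, ?_, ?_⟩
        · rw [support_append, hr, support_cons, ← cons_tail_support p]
          simp
          exact List.perm_middle.symm
        · intro e he hne
          simp only [edges_cons, List.mem_cons] at he
          simp only [edges_append, List.mem_append]
          tauto
      · refine ⟨r.reverse.append p, ?_, ?_⟩
        · rw [support_append, support_reverse, hr, support_cons, ← cons_tail_support p]
          simp
          refine List.Perm.trans ?_ List.perm_middle.symm
          exact ((List.reverse_perm M).append_right _).cons _
        · intro e he hne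
          simp only [edges_cons, List.mem_cons] at he
          simp only [edges_append, List.mem_append]
          rw [Sym2.eq_swap] at hne
          tauto
    · have hp' : s(a, b) ∈ p.edges := by
        simp only [edges_cons, List.mem_cons] at hp
        tauto
      obtain ⟨q, hq, hqe⟩ := ih hp'
      refine ⟨cons h q, ?_, ?_⟩
      · rw [support_cons, support_cons]
        exact (hq.cons _).trans List.perm_middle.symm
      · intro e he hne
        simp only [edges_cons, List.mem_cons] at he ⊢
        obtain he | he := he
        · exact Or.inl he
        · exact Or.inr (hqe e he hne)

end SimpleGraph.Walk

namespace SimpleGraph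

/-- A path through all vertices but `u`, with both ends adjacent to `u`, closes up to a
Hamiltonian cycle. -/
theorem isHamiltonian_of_isPath {V : Type*} [Fintype V] [DecidableEq V] {G : SimpleGraph V}
    {u s t : V} (p : G.Walk s t) (hp : p.IsPath) (hu : u ∉ p.support) (hs : G.Adj u s)
    (ht : G.Adj u t) (hpos : p.length ≠ 0) (hlen : p.length + 2 = Fintype.card V) :
    G.IsHamiltonian := by
  intro _
  refine ⟨u, Walk.cons hs (p.concat ht.symm), ?_⟩
  rw [Walk.isHamiltonianCycle_iff_isCycle_and_length_eq, Walk.cons_isCycle_iff,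
    Walk.concat_isPath_iff]
  refine ⟨⟨⟨hp, hu⟩, ?_⟩, by simpa using hlen⟩
  rw [Walk.edges_concat, List.concat_eq_append, List.mem_append, List.mem_singleton]
  rintro (h | h)
  · exact hu (p.fst_mem_support_of_mem_edges h)
  · have hst : s = t := by
      rcases Sym2.eq_iff.1 h with ⟨h1, -⟩ | ⟨-, h2⟩
      · exact absurd h1 ht.ne
      · exact h2
    subst hst
    exact hpos (Walk.length_eq_zero_iff.2 (Walk.isPath_iff_nil.1 hp))

/-- A sequence of successively adjacent vertices, as a walk. -/
theorem exists_walk_of_forall_adj_succ {V : Type*} {G : SimpleGraph V} (v : ℕ → V) (n : ℕ)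
    (hv : ∀ i < n, G.Adj (v i) (v (i + 1))) :
    ∃ p : G.Walk (v 0) (v n), p.support = (List.range (n + 1)).map v ∧
      ∀ i < n, s(v i, v (i + 1)) ∈ p.edges := by
  induction n with
  | zero => exact ⟨Walk.nil, by simp, by simp⟩
  | succ n ih =>
    obtain ⟨p, hp, hpe⟩ := ih fun i hi => hv i (by omega)
    refine ⟨p.concat (hv n (by omega)), ?_, ?_⟩
    · rw [Walk.support_concat, hp, List.range_succ (n := n + 1)]
      simp
    · intro i hi
      rw [Walk.edges_concat, List.concat_eq_append, List.mem_append, List.mem_singleton]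
      obtain hi | rfl := Nat.lt_succ_iff_lt_or_eq.1 hi
      · exact Or.inl (hpe i hi)
      · exact Or.inr rfl

end SimpleGraph

namespace LocallyPath

variable {V : Type*} {G : SimpleGraph V}

/-- The neighborhood of a vertex is spanned by a path containing all edges inside it. -/
theorem exists_path (hG : LocallyPath G) (u : V) :
    ∃ (s t : V) (p : G.Walk s t), p.IsPath ∧ (∀ w, w ∈ p.support ↔ G.Adj u w) ∧
      ∀ a b, G.Adj u a → G.Adj u b → G.Adj a b → s(a, b) ∈ p.edges := by
  obtain ⟨n, ⟨f⟩⟩ := hG u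
  let v : ℕ → V := fun i => (f.symm (Fin.ofNat (n + 1) i)).1
  have hval : ∀ i ≤ n, (Fin.ofNat (n + 1) i).val = i := fun i hi => by
    simp [Nat.mod_eq_of_lt (Nat.lt_succ_of_le hi)]
  have hof : ∀ a : G.neighborSet u, v (f a).val = a := fun a => by
    have : Fin.ofNat (n + 1) (f a).val = f a := Fin.ext (hval _ (by omega))
    simp only [v, this, RelIso.symm_apply_apply]
  obtain ⟨p, hp, hpe⟩ := SimpleGraph.exists_walk_of_forall_adj_succ (G := G) v n (by
    intro i hi
    have : (SimpleGraph.pathGraph (n + 1)).Adj (Fin.ofNat (n + 1) i) (Fin.ofNat (n + 1) (i + 1)) := by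
      rw [SimpleGraph.pathGraph_adj, hval i hi.le, hval (i + 1) hi]
      exact Or.inl rfl
    exact f.symm.map_adj_iff.2 this)
  refine ⟨v 0, v n, p, ?_, ?_, ?_⟩
  · rw [SimpleGraph.Walk.isPath_def, hp]
    refine List.Nodup.map_on ?_ List.nodup_range
    intro i hi j hj hij
    rw [List.mem_range] at hi hj
    have := congrArg Fin.val (f.symm.injective (Subtype.ext hij))
    rwa [hval i (by omega), hval j (by omega)] at this
  · intro w
    rw [hp, List.mem_map]
    constructor
    · rintro ⟨i, -, rfl⟩
      exact (f.symm (Fin.ofNat (n + 1) i)).2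
    · intro hw
      exact ⟨(f ⟨w, hw⟩).val, List.mem_range.2 (f ⟨w, hw⟩).2, hof ⟨w, hw⟩⟩
  · intro a b ha hb hab
    have h : (SimpleGraph.pathGraph (n + 1)).Adj (f ⟨a, ha⟩) (f ⟨b, hb⟩) := f.map_adj_iff.2 hab
    have hfa := hof ⟨a, ha⟩
    have hfb := hof ⟨b, hb⟩
    have hla := (f ⟨a, ha⟩).2
    have hlb := (f ⟨b, hb⟩).2
    rcases SimpleGraph.pathGraph_adj.1 h with h | h
    · have := hpe (f ⟨a, ha⟩).val (by omega)
      rwa [h, hfa, hfb] at this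
    · have := hpe (f ⟨b, hb⟩).val (by omega)
      rwa [h, hfa, hfb, Sym2.eq_swap] at this

/-- Neighborhoods are connected: some edge leaves any part of a neighborhood. -/
theorem exists_adj_boundary (hG : LocallyPath G) {v a b : V} (S : Set V) (ha : G.Adj v a)
    (hb : G.Adj v b) (haS : a ∈ S) (hbS : b ∉ S) :
    ∃ c d, G.Adj v c ∧ G.Adj v d ∧ c ∈ S ∧ d ∉ S ∧ G.Adj c d := by
  obtain ⟨n, ⟨f⟩⟩ := hG v
  have hc := f.connected_iff.2 (SimpleGraph.pathGraph_connected n)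
  obtain ⟨p⟩ := hc.preconnected ⟨a, ha⟩ ⟨b, hb⟩
  obtain ⟨d, -, h1, h2⟩ := p.exists_boundary_dart (Subtype.val ⁻¹' S) haS hbS
  exact ⟨d.fst, d.snd, d.fst.2, d.snd.2, h1, h2, d.adj⟩

/-- A vertex of a neighborhood has at most two neighbors in it. -/
theorem not_three_adj (hG : LocallyPath G) {v a x y z : V} (ha : G.Adj v a) (hx : G.Adj v x)
    (hy : G.Adj v y) (hz : G.Adj v z) (hax : G.Adj a x) (hay : G.Adj a y) (haz : G.Adj a z)
    (hxy : x ≠ y) (hxz : x ≠ z) (hyz : y ≠ z) : False := by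
  obtain ⟨n, ⟨f⟩⟩ := hG v
  have h (w : V) (hw : G.Adj v w) (haw : G.Adj a w) :
      (f ⟨a, ha⟩).val + 1 = (f ⟨w, hw⟩).val ∨ (f ⟨w, hw⟩).val + 1 = (f ⟨a, ha⟩).val :=
    SimpleGraph.pathGraph_adj.1 (f.map_adj_iff.2 (show (G.induce _).Adj ⟨a, ha⟩ ⟨w, hw⟩ from haw))
  have hne (w w' : V) (hw : G.Adj v w) (hw' : G.Adj v w') (hww : w ≠ w') :
      (f ⟨w, hw⟩).val ≠ (f ⟨w', hw'⟩).val := fun e =>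
    hww (congrArg Subtype.val (f.injective (Fin.ext e)))
  have := h x hx hax
  have := h y hy hay
  have := h z hz haz
  have := hne x y hx hy hxy
  have := hne x z hx hz hxz
  have := hne y z hy hz hyz
  omega

theorem exists_adj (hG : LocallyPath G) (v : V) : ∃ w, G.Adj v w := by
  obtain ⟨n, ⟨f⟩⟩ := hG v
  exact ⟨(f.symm 0).1, (f.symm 0).2⟩

/-- An isolated vertex of `G - N[u]` is adjacent to both ends of some edge inside `N(u)`. -/
theorem exists_triangle (hG : LocallyPath G) {u x : V} (hux : u ≠ x)
    (hx : ∀ w, G.Adj x w → G.Adj u w) :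
    ∃ a b, G.Adj u a ∧ G.Adj u b ∧ G.Adj a b ∧ G.Adj x a ∧ G.Adj x b := by
  obtain ⟨a, ha⟩ := hG.exists_adj x
  obtain ⟨c, b, -, hb, rfl, -, hcb⟩ := hG.exists_adj_boundary {x} ha.symm (hx a ha).symm rfl hux
  exact ⟨a, b, hx a ha, hx b hcb, hb, ha, hcb⟩

/-- If exactly two adjacent vertices `x`, `y` lie outside `N[u]`, then they can be inserted
together along some edge inside `N(u)`. -/
theorem exists_four_cycle (hG : LocallyPath G) (hconn : G.Connected) {u x y : V}
    (hux : u ≠ x) (huy : u ≠ y) (hnx : ¬ G.Adj u x) (hny : ¬ G.Adj u y) (hxy : G.Adj x y)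
    (h : ∀ w, w ≠ u → w ≠ x → w ≠ y → G.Adj u w) :
    ∃ a b, G.Adj u a ∧ G.Adj u b ∧ G.Adj a b ∧ G.Adj a x ∧ G.Adj y b := by
  obtain ⟨w, hwx, hwy⟩ : ∃ w, G.Adj w x ∧ G.Adj w y := by
    obtain ⟨p⟩ := hconn.preconnected x u
    obtain ⟨d, -, h1, h2⟩ := p.exists_boundary_dart {x, y} (by simp) (by simp [hux, huy])
    have hd := d.adj
    simp only [Set.mem_insert_iff, Set.mem_singleton_iff, not_or] at h1 h2
    obtain h1 | h1 := h1
    · rw [h1] at hd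
      obtain ⟨c, w, -, hw, rfl, -, hcw⟩ := hG.exists_adj_boundary {y} hxy hd rfl h2.2
      exact ⟨w, hw.symm, hcw.symm⟩
    · rw [h1] at hd
      obtain ⟨c, w, -, hw, rfl, -, hcw⟩ := hG.exists_adj_boundary {x} hxy.symm hd rfl h2.1
      exact ⟨w, hcw.symm, hw.symm⟩
  have hwu : G.Adj u w :=
    h w (fun e => hnx (e ▸ hwx)) hwx.ne hwy.ne
  obtain ⟨c, b, -, hb, hc, hbS, hcb⟩ := hG.exists_adj_boundary {x, y} hwx hwu.symm (by simp)
    (show u ∉ _ by simp [hux, huy])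
  simp only [Set.mem_insert_iff, Set.mem_singleton_iff, not_or] at hc hbS
  have hbu : b ≠ u := by
    rintro rfl
    obtain rfl | rfl := hc
    · exact hnx hcb.symm
    · exact hny hcb.symm
  have hub := h b hbu hbS.1 hbS.2
  obtain rfl | rfl := hc
  · exact ⟨b, w, hub, hwu, hb.symm, hcb.symm, hwy.symm⟩
  · exact ⟨w, b, hwu, hub, hb, hwx, hcb⟩

end LocallyPath

/-- Any locally linear graph on `n` vertices with a vertex of degree `n - 3`
is hamiltonian. -/
theorem stmt_16 {V : Type*} [Fintype V] [DecidableEq V] (G : SimpleGraph V)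
    [DecidableRel G.Adj]
    (hconn : G.Connected) (hG : LocallyPath G)
    (u : V) (hu : G.degree u = Fintype.card V - 3) :
    G.IsHamiltonian := by
  have hdeg : 0 < G.degree u := (G.degree_pos_iff_exists_adj u).2 (hG.exists_adj u)
  obtain ⟨x, y, hxy, hout⟩ : ∃ x y, x ≠ y ∧ (insert u (G.neighborFinset u))ᶜ = {x, y} := by
    rw [← Finset.card_eq_two, Finset.card_compl, Finset.card_insert_of_notMem (by simp),
      G.card_neighborFinset_eq_degree]
    omega
  have hmem (w : V) : (w ≠ u ∧ ¬ G.Adj u w) ↔ w = x ∨ w = y := by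
    simpa using Finset.ext_iff.1 hout w
  obtain ⟨hux, hnx⟩ := (hmem x).2 (Or.inl rfl)
  obtain ⟨huy, hny⟩ := (hmem y).2 (Or.inr rfl)
  have hin (w : V) (h1 : w ≠ u) (h2 : w ≠ x) (h3 : w ≠ y) : G.Adj u w := by
    by_contra h
    exact ((hmem w).1 ⟨h1, h⟩).elim h2 h3
  obtain ⟨s, t, p, hp, hsupp, hedge⟩ := hG.exists_path u
  have hs : G.Adj u s := (hsupp s).1 p.start_mem_support
  have ht : G.Adj u t := (hsupp t).1 p.end_mem_support
  have hlen : p.support.length = G.degree u := by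
    rw [← G.card_neighborFinset_eq_degree, ← List.toFinset_card_of_nodup hp.support_nodup]
    congr 1
    ext w
    simp [hsupp]
  suffices ∃ q : G.Walk s t, q.support.Perm (x :: y :: p.support) by
    obtain ⟨q, hq⟩ := this
    have hql := hq.length_eq
    rw [SimpleGraph.Walk.length_support, List.length_cons, List.length_cons, hlen] at hql
    refine SimpleGraph.isHamiltonian_of_isPath q ?_ ?_ hs ht (by omega) (by omega)
    · rw [SimpleGraph.Walk.isPath_def, hq.nodup_iff]
      simp [hxy, hsupp, hnx, hny, hp.support_nodup]
    · rw [hq.mem_iff]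
      simp [hsupp, hux.symm, huy.symm]
  by_cases hadj : G.Adj x y
  · obtain ⟨a, b, ha, hb, hab, hax, hyb⟩ :=
      hG.exists_four_cycle hconn hux.symm huy.symm hnx hny hadj hin
    obtain ⟨q, hq, -⟩ := SimpleGraph.Walk.exists_detour
      (.cons hax (.cons hadj (.cons hyb .nil))) [x, y] rfl p (hedge a b ha hb hab)
    exact ⟨q, hq⟩
  · obtain ⟨a, b, ha, hb, hab, hxa, hxb⟩ := hG.exists_triangle hux.symm fun w hw =>
      hin w (fun e => hnx (e ▸ hw.symm)) hw.ne' fun e => hadj (e ▸ hw)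
    obtain ⟨c, d, hc, hd, hcd, hyc, hyd⟩ := hG.exists_triangle huy.symm fun w hw =>
      hin w (fun e => hny (e ▸ hw.symm)) (fun e => hadj (e ▸ hw.symm)) hw.ne'
    have hne : s(c, d) ≠ s(a, b) := by
      intro e
      have hyab : G.Adj y a ∧ G.Adj y b := by
        obtain ⟨rfl, rfl⟩ | ⟨rfl, rfl⟩ := Sym2.eq_iff.1 e
        · exact ⟨hyc, hyd⟩
        · exact ⟨hyd, hyc⟩
      exact hG.not_three_adj hab ha.symm hxa.symm hyab.1.symm hb.symm hxb.symm hyab.2.symm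
        hux.symm huy.symm hxy
    obtain ⟨q, hq, hqe⟩ := SimpleGraph.Walk.exists_detour
      (.cons hxa.symm (.cons hxb .nil)) [x] rfl p (hedge a b ha hb hab)
    obtain ⟨q', hq', -⟩ := SimpleGraph.Walk.exists_detour
      (.cons hyc.symm (.cons hyd .nil)) [y] rfl q (hqe _ (hedge c d hc hd hcd) hne)
    exact ⟨q', hq'.trans ((hq.cons y).trans (List.Perm.swap _ _ _))⟩
end

section
/- Any locally linear graph on n vertices with a vertex of degree n−4 is hamiltonian. -/
/-- `f 0, …, f m` enumerates the neighbors of `v` along an induced path. -/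
structure IsLinkEnum {V : Type*} (G : SimpleGraph V) (v : V) (m : ℕ) (f : ℕ → V) : Prop where
  adj_center : ∀ i ≤ m, G.Adj v (f i)
  surj : ∀ w, G.Adj v w → ∃ i ≤ m, f i = w
  inj : ∀ i ≤ m, ∀ j ≤ m, f i = f j → i = j
  adj_iff : ∀ i ≤ m, ∀ j ≤ m, (G.Adj (f i) (f j) ↔ i + 1 = j ∨ j + 1 = i)

section

variable {V : Type*} {G : SimpleGraph V}

lemma LocallyPath.exists_isLinkEnum (hG : LocallyPath G) (v : V) :
    ∃ m f, IsLinkEnum G v m f := by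
  obtain ⟨m, ⟨e⟩⟩ := hG v
  refine ⟨m, fun i => e.symm (Fin.ofNat (m + 1) i), ?_, ?_, ?_, ?_⟩
  · intro i _
    exact (e.symm (Fin.ofNat (m + 1) i)).2
  · intro w hw
    refine ⟨e ⟨w, hw⟩, by omega, ?_⟩
    simp
  · intro i hi j hj h
    have := congrArg Fin.val (e.symm.injective (Subtype.ext h))
    simpa [Nat.mod_eq_of_lt (Nat.lt_succ_of_le hi), Nat.mod_eq_of_lt (Nat.lt_succ_of_le hj)]
      using this
  · intro i hi j hj
    have := e.symm.map_rel_iff (a := Fin.ofNat (m + 1) i) (b := Fin.ofNat (m + 1) j)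
    rw [SimpleGraph.pathGraph_adj] at this
    simpa [Nat.mod_eq_of_lt (Nat.lt_succ_of_le hi), Nat.mod_eq_of_lt (Nat.lt_succ_of_le hj)]
      using this

lemma IsLinkEnum.rev {v : V} {m : ℕ} {f : ℕ → V} (h : IsLinkEnum G v m f) :
    IsLinkEnum G v m (fun i => f (m - i)) where
  adj_center i _ := h.adj_center _ (by omega)
  surj w hw := by
    obtain ⟨i, hi, rfl⟩ := h.surj w hw
    exact ⟨m - i, by omega, by congr 1; omega⟩
  inj i hi j hj hij := by
    have := h.inj _ (by omega) _ (by omega) hij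
    omega
  adj_iff i hi j hj := by
    rw [h.adj_iff _ (by omega) _ (by omega)]
    omega

/-- Two distinct neighbors of `v` occur in either order along a suitable enumeration. -/
lemma LocallyPath.exists_isLinkEnum_lt (hG : LocallyPath G) {v a b : V} (ha : G.Adj v a)
    (hb : G.Adj v b) (hab : a ≠ b) :
    ∃ m f i j, IsLinkEnum G v m f ∧ i < j ∧ j ≤ m ∧ f i = a ∧ f j = b := by
  obtain ⟨m, f, h⟩ := hG.exists_isLinkEnum v
  obtain ⟨i, hi, rfl⟩ := h.surj a ha
  obtain ⟨j, hj, rfl⟩ := h.surj b hb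
  rcases lt_trichotomy i j with hij | rfl | hij
  · exact ⟨m, f, i, j, h, hij, hj, rfl, rfl⟩
  · exact absurd rfl hab
  · exact ⟨m, _, m - i, m - j, h.rev, by omega, by omega, by congr 1; omega, by congr 1; omega⟩

/-- The vertices of the neighborhood of `v` have at most two neighbors in it. -/
lemma LocallyPath.eq_of_adj (hG : LocallyPath G) {v x a b c : V} (hx : G.Adj v x)
    (ha : G.Adj v a) (hb : G.Adj v b) (hc : G.Adj v c)
    (hxa : G.Adj x a) (hxb : G.Adj x b) (hxc : G.Adj x c) : a = b ∨ a = c ∨ b = c := by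
  obtain ⟨m, f, h⟩ := hG.exists_isLinkEnum v
  obtain ⟨i, hi, rfl⟩ := h.surj a ha
  obtain ⟨j, hj, rfl⟩ := h.surj b hb
  obtain ⟨k, hk, rfl⟩ := h.surj c hc
  obtain ⟨l, hl, rfl⟩ := h.surj x hx
  rw [h.adj_iff _ hl _ ‹_›] at hxa hxb hxc
  have : i = j ∨ i = k ∨ j = k := by omega
  rcases this with rfl | rfl | rfl <;> simp

/-- The neighborhood of `v` contains no 4-cycle. -/
lemma LocallyPath.eq_of_four_cycle (hG : LocallyPath G) {v a b c d : V}
    (ha : G.Adj v a) (hb : G.Adj v b) (hc : G.Adj v c) (hd : G.Adj v d)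
    (hab : G.Adj a b) (hbc : G.Adj b c) (hcd : G.Adj c d) (hda : G.Adj d a) :
    a = c ∨ b = d := by
  obtain ⟨m, f, h⟩ := hG.exists_isLinkEnum v
  obtain ⟨i, hi, rfl⟩ := h.surj a ha
  obtain ⟨j, hj, rfl⟩ := h.surj b hb
  obtain ⟨k, hk, rfl⟩ := h.surj c hc
  obtain ⟨l, hl, rfl⟩ := h.surj d hd
  rw [h.adj_iff _ ‹_› _ ‹_›] at hab hbc hcd hda
  have : i = k ∨ j = l := by omega
  rcases this with rfl | rfl <;> simp

lemma exists_walk_support_eq {a b : V} {L : List V} (h : (a :: (L ++ [b])).IsChain G.Adj) :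
    ∃ p : G.Walk a b, p.support = a :: (L ++ [b]) := by
  have hl : (a :: (L ++ [b])).getLast (List.cons_ne_nil _ _) = b := by simp
  exact ⟨(SimpleGraph.Walk.ofSupport _ (List.cons_ne_nil _ _) h).copy List.head_cons hl,
    (SimpleGraph.Walk.support_copy _ _ _).trans (SimpleGraph.Walk.support_ofSupport _ h)⟩

lemma isHamiltonian_of_isChain [Fintype V] [DecidableEq V] {u : V} {L : List V}
    (hL : (u :: (L ++ [u])).IsChain G.Adj) (hnd : (u :: L).Nodup) (hmem : ∀ v, v = u ∨ v ∈ L)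
    (hlen : 2 ≤ L.length) : G.IsHamiltonian := by
  intro _
  obtain ⟨p, hp⟩ := exists_walk_support_eq hL
  refine ⟨u, p, ?_⟩
  have hlp : p.length = L.length + 1 := by
    have := p.length_support
    rw [hp] at this
    simp at this
    omega
  have hnil : ¬ p.Nil := by
    rw [SimpleGraph.Walk.not_nil_iff_lt_length]; omega
  have hnd' : (L ++ [u]).Nodup := by
    rw [List.nodup_append_comm]; exact hnd
  have htail : p.tail.support = L ++ [u] := by
    rw [p.support_tail_of_not_nil hnil, hp, List.tail_cons]
  have hpath : p.tail.IsPath := by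
    rw [SimpleGraph.Walk.isPath_def, htail]; exact hnd'
  rw [SimpleGraph.Walk.isHamiltonianCycle_isCycle_and_isHamiltonian_tail,
    SimpleGraph.Walk.isCycle_iff_isPath_tail_and_le_length]
  refine ⟨⟨hpath, by omega⟩, hpath.isHamiltonian_of_mem fun w => ?_⟩
  rw [htail]
  rcases hmem w with rfl | h <;> simp [*]

/-- `s` lies outside the closed neighborhood of `u`. -/
def IsFar (G : SimpleGraph V) (u s : V) : Prop := s ≠ u ∧ ¬ G.Adj u s

/-- Insert the lists `Q i` between consecutive vertices of the path around `u`. -/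
lemma IsLinkEnum.isHamiltonian_of_insertions [Fintype V] [DecidableEq V] {u : V} {m : ℕ}
    {p : ℕ → V} (h : IsLinkEnum G u m p) (hm : 1 ≤ m) (Q : ℕ → List V)
    (hch : ∀ i < m, (p i :: (Q i ++ [p (i + 1)])).IsChain G.Adj)
    (hnd : ∀ i < m, (Q i).Nodup)
    (hdj : ∀ i < m, ∀ j < m, ∀ s, s ∈ Q i → s ∈ Q j → i = j)
    (hfar : ∀ i < m, ∀ s ∈ Q i, IsFar G u s)
    (hcov : ∀ s, IsFar G u s → ∃ i < m, s ∈ Q i) : G.IsHamiltonian := by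
  have key : ∀ k ≤ m, (u :: ((List.range k).flatMap (fun i => p i :: Q i) ++ [p k])).IsChain
      G.Adj := by
    intro k
    induction k with
    | zero => intro _; simpa using h.adj_center 0 (by omega)
    | succ k ih =>
      intro hk
      have h1 := ih (by omega)
      have h2 := hch k (by omega)
      rw [List.range_succ, List.flatMap_append]
      simp only [List.flatMap_cons, List.flatMap_nil, List.append_nil, List.append_assoc,
        List.cons_append]
      rw [← List.cons_append, List.isChain_split]
      exact ⟨h1, h2⟩
  have hp : ∀ i ≤ m, p i ≠ u := fun i hi => (h.adj_center i hi).ne'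
  refine isHamiltonian_of_isChain (u := u)
    (L := (List.range m).flatMap (fun i => p i :: Q i) ++ [p m]) ?_ ?_ ?_ ?_
  · have h1 := key m le_rfl
    rw [List.append_assoc, List.singleton_append, ← List.cons_append, List.isChain_split]
    exact ⟨h1, by simpa using (h.adj_center m le_rfl).symm⟩
  · rw [List.nodup_cons, List.nodup_append, List.nodup_flatMap]
    refine ⟨?_, ⟨?_, ?_⟩, by simp, ?_⟩
    · simp only [List.mem_append, List.mem_flatMap, List.mem_range, List.mem_cons,
        List.not_mem_nil, or_false, not_or, not_exists, not_and]
      exact ⟨fun i hi => ⟨(hp i hi.le).symm, fun hu => (hfar i hi u hu).1 rfl⟩,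
        (hp m le_rfl).symm⟩
    · intro i hi
      rw [List.mem_range] at hi
      exact List.nodup_cons.2 ⟨fun hu => (hfar i hi _ hu).2 (h.adj_center i hi.le), hnd i hi⟩
    · refine List.Nodup.pairwise_of_forall_ne List.nodup_range ?_
      intro i hi j hj hij
      rw [List.mem_range] at hi hj
      intro s hs ht
      rw [List.mem_cons] at hs ht
      rcases hs with rfl | hs <;> rcases ht with ht | ht
      · exact hij (h.inj i hi.le j hj.le ht)
      · exact (hfar j hj _ ht).2 (h.adj_center i hi.le)
      · subst ht; exact (hfar i hi _ hs).2 (h.adj_center j hj.le)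
      · exact hij (hdj i hi j hj s hs ht)
    · intro a ha b hb
      simp only [List.mem_flatMap, List.mem_range, List.mem_cons, List.not_mem_nil,
        or_false] at ha hb
      obtain ⟨i, hi, rfl | ha⟩ := ha
      · rintro rfl
        have := h.inj i hi.le m le_rfl hb
        omega
      · rintro rfl
        subst hb
        exact (hfar i hi _ ha).2 (h.adj_center m le_rfl)
  · intro v
    by_cases hv : v = u
    · exact Or.inl hv
    right
    simp only [List.mem_append, List.mem_flatMap, List.mem_range, List.mem_cons,
      List.not_mem_nil, or_false]
    by_cases hav : G.Adj u v
    · obtain ⟨i, hi, rfl⟩ := h.surj v hav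
      rcases hi.lt_or_eq with hi | rfl
      · exact Or.inl ⟨i, hi, Or.inl rfl⟩
      · exact Or.inr rfl
    · obtain ⟨i, hi, hs⟩ := hcov v ⟨hv, hav⟩
      exact Or.inl ⟨i, hi, Or.inr hs⟩
  · obtain ⟨k, rfl⟩ : ∃ k, m = k + 1 := ⟨m - 1, by omega⟩
    simp [List.range_succ_eq_map]
    omega

/-- `Q` can be inserted between the adjacent neighbors `a` and `b` of `u`. -/
structure IsInsertion (G : SimpleGraph V) (u a b : V) (Q : List V) : Prop where
  left : G.Adj u a
  right : G.Adj u b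
  adj : G.Adj a b
  chain : (a :: (Q ++ [b])).IsChain G.Adj
  nodup : Q.Nodup
  far : ∀ s ∈ Q, IsFar G u s

lemma IsLinkEnum.exists_of_isInsertion {u : V} {m : ℕ} {p : ℕ → V} (h : IsLinkEnum G u m p)
    {a b : V} {Q : List V} (hQ : IsInsertion G u a b Q) :
    ∃ i < m, ∃ Q' : List V, s(p i, p (i + 1)) = s(a, b) ∧ (∀ s, s ∈ Q' ↔ s ∈ Q) ∧ Q'.Nodup ∧
      (p i :: (Q' ++ [p (i + 1)])).IsChain G.Adj := by
  obtain ⟨i, hi, rfl⟩ := h.surj a hQ.left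
  obtain ⟨j, hj, rfl⟩ := h.surj b hQ.right
  rcases (h.adj_iff i hi j hj).1 hQ.adj with rfl | rfl
  · exact ⟨i, by omega, Q, rfl, fun _ => Iff.rfl, hQ.nodup, hQ.chain⟩
  · refine ⟨j, by omega, Q.reverse, Sym2.eq_swap, fun _ => List.mem_reverse,
      List.nodup_reverse.2 hQ.nodup, ?_⟩
    have := List.isChain_reverse.2 (hQ.chain.imp fun _ _ h => h.symm)
    simpa using this

/-- A family of insertions at distinct edges that covers all non-neighbors of `u` yields a
Hamiltonian cycle. -/
lemma LocallyPath.isHamiltonian_of_isInsertion [Fintype V] [DecidableEq V] (hG : LocallyPath G)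
    {u : V} {ι : Type*} [Nonempty ι] (a b : ι → V) (Q : ι → List V)
    (hQ : ∀ k, IsInsertion G u (a k) (b k) (Q k))
    (hinj : ∀ k l, s(a k, b k) = s(a l, b l) → k = l)
    (hdj : ∀ k l s, s ∈ Q k → s ∈ Q l → k = l)
    (hcov : ∀ s, IsFar G u s → ∃ k, s ∈ Q k) : G.IsHamiltonian := by
  classical
  obtain ⟨m, p, h⟩ := hG.exists_isLinkEnum u
  choose i him Q' hi hQ' hnd hch using fun k => h.exists_of_isInsertion (hQ k)
  have hii : ∀ k l, i k = i l → k = l := fun k l hkl =>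
    hinj k l (by rw [← hi k, ← hi l, hkl])
  set R : ℕ → List V := fun j => if hj : ∃ k, i k = j then Q' hj.choose else [] with hR
  have hRi : ∀ k, R (i k) = Q' k := by
    intro k
    have hj : ∃ l, i l = i k := ⟨k, rfl⟩
    have : hj.choose = k := hii _ _ hj.choose_spec
    simp only [hR, dif_pos hj, this]
  have hRn : ∀ j, (¬ ∃ k, i k = j) → R j = [] := fun j hj => by simp only [hR, dif_neg hj]
  have hmem : ∀ j s, s ∈ R j → ∃ k, i k = j ∧ s ∈ Q k := by
    intro j s hs
    by_cases hj : ∃ k, i k = j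
    · obtain ⟨k, rfl⟩ := hj
      rw [hRi, hQ'] at hs
      exact ⟨k, rfl, hs⟩
    · simp [hRn j hj] at hs
  have hm : 1 ≤ m := by
    have := him (Classical.arbitrary ι)
    omega
  refine h.isHamiltonian_of_insertions hm R ?_ ?_ ?_ ?_ ?_
  · intro j hj
    by_cases hk : ∃ k, i k = j
    · obtain ⟨k, rfl⟩ := hk
      rw [hRi]
      exact hch k
    · rw [hRn j hk]
      simpa using (h.adj_iff j hj.le (j + 1) hj).2 (Or.inl rfl)
  · intro j _
    by_cases hk : ∃ k, i k = j
    · obtain ⟨k, rfl⟩ := hk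
      rw [hRi]
      exact hnd k
    · rw [hRn j hk]
      exact List.nodup_nil
  · intro j _ l _ s hs ht
    obtain ⟨k, rfl, hk⟩ := hmem j s hs
    obtain ⟨k', rfl, hk'⟩ := hmem l s ht
    rw [hdj k k' s hk hk']
  · intro j _ s hs
    obtain ⟨k, rfl, hk⟩ := hmem j s hs
    exact (hQ k).far s hk
  · intro s hs
    obtain ⟨k, hk⟩ := hcov s hs
    exact ⟨i k, him k, by rw [hRi, hQ']; exact hk⟩

lemma IsInsertion.singleton {u a b s : V} (ha : G.Adj u a) (hb : G.Adj u b) (hab : G.Adj a b)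
    (hs : IsFar G u s) (has : G.Adj a s) (hsb : G.Adj s b) : IsInsertion G u a b [s] :=
  ⟨ha, hb, hab, by simp [has, hsb], by simp, by simpa using hs⟩

lemma IsInsertion.pair {u a b s t : V} (ha : G.Adj u a) (hb : G.Adj u b) (hab : G.Adj a b)
    (hs : IsFar G u s) (ht : IsFar G u t) (has : G.Adj a s) (hst : G.Adj s t)
    (htb : G.Adj t b) : IsInsertion G u a b [s, t] :=
  ⟨ha, hb, hab, by simp [has, hst, htb], by simp [hst.ne], by simpa using ⟨hs, ht⟩⟩

lemma IsInsertion.triple {u a b s t r : V} (ha : G.Adj u a) (hb : G.Adj u b) (hab : G.Adj a b)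
    (hs : IsFar G u s) (ht : IsFar G u t) (hr : IsFar G u r) (hsr : s ≠ r) (has : G.Adj a s)
    (hst : G.Adj s t) (htr : G.Adj t r) (hrb : G.Adj r b) : IsInsertion G u a b [s, t, r] :=
  ⟨ha, hb, hab, by simp [has, hst, htr, hrb], by simp [hst.ne, htr.ne, hsr],
    by simpa using ⟨hs, ht, hr⟩⟩

/-- An edge inside the neighborhood of `u` lies in at most one triangle avoiding `u`. -/
lemma LocallyPath.eq_of_triangle (hG : LocallyPath G) {u a b s t : V} (ha : G.Adj u a)
    (hb : G.Adj u b) (hab : G.Adj a b) (hs : IsFar G u s) (ht : IsFar G u t)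
    (has : G.Adj a s) (hbs : G.Adj b s) (hat : G.Adj a t) (hbt : G.Adj b t) : s = t := by
  rcases hG.eq_of_adj (v := a) (x := b) hab ha.symm has hat hb.symm hbs hbt with h | h | h
  · exact absurd h.symm hs.1
  · exact absurd h.symm ht.1
  · exact h

/-- Triangles with distinct far apexes have distinct bases inside the neighborhood of `u`. -/
lemma LocallyPath.base_ne (hG : LocallyPath G) {u a b c d s t : V} (ha : G.Adj u a)
    (hb : G.Adj u b) (hab : G.Adj a b) (hs : IsFar G u s) (ht : IsFar G u t)
    (has : G.Adj a s) (hbs : G.Adj b s) (hct : G.Adj c t) (hdt : G.Adj d t) (hst : s ≠ t) :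
    s(a, b) ≠ s(c, d) := by
  intro h
  rcases Sym2.eq_iff.1 h with ⟨rfl, rfl⟩ | ⟨rfl, rfl⟩
  · exact hst (hG.eq_of_triangle ha hb hab hs ht has hbs hct hdt)
  · exact hst (hG.eq_of_triangle ha hb hab hs ht has hbs hdt hct)

section

variable [Fintype V] [DecidableEq V] {u : V}

lemma IsInsertion.isHamiltonian {a b : V} {Q : List V} (hQ : IsInsertion G u a b Q)
    (hG : LocallyPath G) (hcov : ∀ s, IsFar G u s → s ∈ Q) : G.IsHamiltonian :=
  hG.isHamiltonian_of_isInsertion (ι := Unit) (fun _ => a) (fun _ => b) (fun _ => Q)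
    (fun _ => hQ) (fun _ _ _ => rfl) (fun _ _ _ _ _ => rfl)
    (fun s hs => ⟨(), hcov s hs⟩)

lemma IsInsertion.isHamiltonian₂ {a b c d : V} {Q R : List V} (hQ : IsInsertion G u a b Q)
    (hR : IsInsertion G u c d R) (hG : LocallyPath G) (hne : s(a, b) ≠ s(c, d))
    (hdj : ∀ s ∈ Q, s ∉ R) (hcov : ∀ s, IsFar G u s → s ∈ Q ∨ s ∈ R) : G.IsHamiltonian := by
  refine hG.isHamiltonian_of_isInsertion (u := u) (ι := Bool) (fun k => cond k a c)
    (fun k => cond k b d) (fun k => cond k Q R) ?_ ?_ ?_ ?_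
  · simpa using ⟨hR, hQ⟩
  · rintro (_ | _) (_ | _) h
    exacts [rfl, absurd h hne.symm, absurd h hne, rfl]
  · simpa [Bool.forall_bool] using ⟨fun s h h' => hdj s h' h, hdj⟩
  · intro s hs
    simpa [or_comm] using hcov s hs

lemma IsInsertion.isHamiltonian₃ {a b : Fin 3 → V} {s : Fin 3 → V}
    (hQ : ∀ i, IsInsertion G u (a i) (b i) [s i]) (hG : LocallyPath G)
    (hs : Function.Injective s) (hcov : ∀ t, IsFar G u t → ∃ i, t = s i) :
    G.IsHamiltonian := by
  refine hG.isHamiltonian_of_isInsertion a b (fun i => [s i]) hQ ?_ ?_ ?_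
  · intro k l h
    by_contra hkl
    have h1 := (hQ k).chain
    have h2 := (hQ l).chain
    simp only [List.singleton_append, List.isChain_cons_cons, List.isChain_singleton,
      and_true] at h1 h2
    exact hG.base_ne (hQ k).left (hQ k).right (hQ k).adj ((hQ k).far _ (by simp))
      ((hQ l).far _ (by simp)) h1.1 h1.2.symm h2.1 h2.2.symm (fun h => hkl (hs h)) h
  · intro k l t hk hl
    rw [List.mem_singleton] at hk hl
    exact hs (hk.symm.trans hl)
  · intro t ht
    simpa using hcov t ht

end

/-- `s` is the apex of a triangle whose base lies in the neighborhood of `u`. -/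
def IsTip (G : SimpleGraph V) (u s : V) : Prop :=
  ∃ a b, G.Adj u a ∧ G.Adj u b ∧ G.Adj a b ∧ G.Adj a s ∧ G.Adj b s

/-- Exactly three vertices lie outside the closed neighborhood of `u`. -/
def HasThreeFar (G : SimpleGraph V) (u : V) : Prop :=
  ∃ x y z, x ≠ y ∧ x ≠ z ∧ y ≠ z ∧ ∀ s, IsFar G u s ↔ s = x ∨ s = y ∨ s = z

lemma HasThreeFar.third {u : V} (h3 : HasThreeFar G u) (s t : V) (hs : IsFar G u s)
    (ht : IsFar G u t) (hst : s ≠ t) :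
    ∃ r, IsFar G u r ∧ r ≠ s ∧ r ≠ t ∧ ∀ v, IsFar G u v → v = s ∨ v = t ∨ v = r := by
  obtain ⟨x, y, z, hxy, hxz, hyz, h⟩ := h3
  rw [h] at hs ht
  have key : ∃ r, (r = x ∨ r = y ∨ r = z) ∧ r ≠ s ∧ r ≠ t := by
    by_cases hx : x = s ∨ x = t
    · by_cases hy : y = s ∨ y = t
      · exact ⟨z, by grind⟩
      · exact ⟨y, by grind⟩
    · exact ⟨x, by grind⟩
  obtain ⟨r, hr, hrs, hrt⟩ := key
  exact ⟨r, (h r).2 hr, hrs, hrt, fun v hv => by have := (h v).1 hv; grind⟩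

/-- The part of the neighborhood of `p` between `u` and a far vertex `s`. -/
lemma LocallyPath.link_cases [Fintype V] [DecidableEq V] (hG : LocallyPath G) {u p s : V}
    (h3 : HasThreeFar G u) (hs : IsFar G u s) (hup : G.Adj u p) (hps : G.Adj p s) :
    G.IsHamiltonian ∨ ∃ q, G.Adj u q ∧ G.Adj p q ∧ (G.Adj q s ∨
      ∃ t, IsFar G u t ∧ t ≠ s ∧ G.Adj q t ∧ G.Adj p t ∧ G.Adj t s) := by
  obtain ⟨m, f, i, j, h, hij, hj, hi, rfl⟩ := hG.exists_isLinkEnum_lt hup.symm hps hs.1.symm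
  have hij1 : j ≠ i + 1 := by
    rintro rfl
    refine hs.2 ?_
    rw [← hi]
    exact (h.adj_iff i (by omega) (i + 1) hj).2 (Or.inl rfl)
  have far : ∀ k, i + 2 ≤ k → k ≤ m → IsFar G u (f k) := by
    intro k hk hkm
    constructor
    · rw [← hi]
      intro hki
      have := h.inj k hkm i (by omega) hki
      omega
    · rw [← hi, h.adj_iff i (by omega) k hkm]
      omega
  have succ : ∀ k, k < m → G.Adj (f k) (f (k + 1)) := fun k hk =>
    (h.adj_iff k hk.le (k + 1) hk).2 (Or.inl rfl)
  have ne : ∀ k l, k < l → l ≤ m → f k ≠ f l := by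
    intro k l hkl hl hkl'
    have := h.inj k (by omega) l hl hkl'
    omega
  have huq : G.Adj u (f (i + 1)) := by
    have := succ i (by omega)
    rwa [hi] at this
  have hpq := h.adj_center (i + 1) (by omega)
  by_cases hj2 : j = i + 2
  · subst hj2
    exact Or.inr ⟨_, huq, hpq, Or.inl (succ (i + 1) (by omega))⟩
  by_cases hj3 : j = i + 3
  · subst hj3
    exact Or.inr ⟨_, huq, hpq, Or.inr ⟨f (i + 2), far _ le_rfl (by omega),
      ne _ _ (by omega) (by omega), succ (i + 1) (by omega), h.adj_center _ (by omega),
      succ (i + 2) (by omega)⟩⟩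
  left
  obtain ⟨r, _, _, _, hr⟩ := h3.third _ _ (far (i + 2) le_rfl (by omega))
    (far (i + 3) (by omega) (by omega)) (ne _ _ (by omega) (by omega))
  have e4 : f (i + 4) = r := by
    rcases hr _ (far (i + 4) (by omega) (by omega)) with h' | h' | h'
    · exact absurd h'.symm (ne _ _ (by omega) (by omega))
    · exact absurd h'.symm (ne _ _ (by omega) (by omega))
    · exact h'
  refine (IsInsertion.triple huq hup hpq.symm (far (i + 2) le_rfl (by omega))
    (far (i + 3) (by omega) (by omega)) (far (i + 4) (by omega) (by omega))
    (ne _ _ (by omega) (by omega)) (succ (i + 1) (by omega)) (succ (i + 2) (by omega))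
    (succ (i + 3) (by omega)) (h.adj_center _ (by omega)).symm).isHamiltonian hG ?_
  intro v hv
  simpa [e4] using hr v hv

lemma HasThreeFar.isHamiltonian_of_triple [Fintype V] [DecidableEq V] (hG : LocallyPath G)
    {u a b s t r : V} (h3 : HasThreeFar G u) (ha : G.Adj u a) (hb : G.Adj u b)
    (hab : G.Adj a b) (hs : IsFar G u s) (ht : IsFar G u t) (hr : IsFar G u r) (hsr : s ≠ r)
    (has : G.Adj a s) (hst : G.Adj s t) (htr : G.Adj t r) (hrb : G.Adj r b) :
    G.IsHamiltonian := by
  refine (IsInsertion.triple ha hb hab hs ht hr hsr has hst htr hrb).isHamiltonian hG ?_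
  intro v hv
  obtain ⟨w, _, _, _, hw⟩ := h3.third s t hs ht hst.ne
  have : r = w := by
    rcases hw r hr with h | h | h
    · exact absurd h.symm hsr
    · exact absurd h.symm htr.ne
    · exact h
  simpa [this] using hw v hv

/-- The case of a far vertex without neighbors in the neighborhood of `u`. -/
lemma HasThreeFar.isHamiltonian_of_isolated [Fintype V] [DecidableEq V] (hG : LocallyPath G)
    {u z s p : V} (h3 : HasThreeFar G u) (hz : IsFar G u z)
    (hzu : ∀ q, G.Adj u q → ¬ G.Adj z q) (hs : IsFar G u s) (hsz : G.Adj s z)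
    (hup : G.Adj u p) (hsp : G.Adj s p) : G.IsHamiltonian := by
  obtain ⟨t, ht, hts, htz, hcov⟩ := h3.third s z hs hz hsz.ne
  obtain ⟨m, f, i, j, h, hij, hj, rfl, rfl⟩ := hG.exists_isLinkEnum_lt hsz hsp
    (fun h => hz.2 (h ▸ hup))
  have nbr : ∀ k ≤ m, IsFar G u (f k) ∨ G.Adj u (f k) := by
    intro k hk
    by_cases hfk : G.Adj u (f k)
    · exact Or.inr hfk
    · refine Or.inl ⟨fun h' => ?_, hfk⟩
      exact hs.2 (h' ▸ (h.adj_center k hk).symm)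
  have succ : ∀ k, k < m → G.Adj (f k) (f (k + 1)) := fun k hk =>
    (h.adj_iff k hk.le (k + 1) hk).2 (Or.inl rfl)
  have h1 : f (i + 1) = t := by
    rcases nbr (i + 1) (by omega) with h' | h'
    · rcases hcov _ h' with h' | h' | h'
      · exact absurd h' (h.adj_center (i + 1) (by omega)).ne'
      · have := h.inj _ (by omega) _ (by omega) h'
        omega
      · exact h'
    · exact absurd (succ i (by omega)) (hzu _ h')
  have hij1 : j ≠ i + 1 := by
    rintro rfl
    exact ht.2 (h1 ▸ hup)
  have h2 : G.Adj u (f (i + 2)) := by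
    rcases nbr (i + 2) (by omega) with h' | h'
    · rcases hcov _ h' with h' | h' | h'
      · exact absurd h' (h.adj_center (i + 2) (by omega)).ne'
      · have := h.inj _ (by omega) _ (by omega) h'
        omega
      · have := h.inj _ (by omega) _ (by omega) (h'.trans h1.symm)
        omega
    · exact h'
  have hzt : G.Adj (f i) t := h1 ▸ succ i (by omega)
  have hst : G.Adj s t := h1 ▸ h.adj_center (i + 1) (by omega)
  have htp : G.Adj t (f (i + 2)) := h1 ▸ succ (i + 1) (by omega)
  have hsp' := h.adj_center (i + 2) (by omega)
  rcases hG.link_cases h3 hs h2 hsp'.symm with h' | ⟨q, huq, hpq, hqs | ⟨w, hw, hws, hqw, hpw, _⟩⟩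
  · exact h'
  · exact h3.isHamiltonian_of_triple hG huq h2 hpq.symm hs hz ht hts.symm hqs hsz hzt htp
  · rcases hcov w hw with rfl | rfl | rfl
    · exact absurd rfl hws
    · exact absurd hpw.symm (hzu _ h2)
    · exact h3.isHamiltonian_of_triple hG huq h2 hpq.symm hw hz hs hts hqw hzt.symm
        hsz.symm hsp'

/-- The case of two far vertices that both hang on the same tip. -/
lemma HasThreeFar.isHamiltonian_of_unique_tip [Fintype V] [DecidableEq V] (hG : LocallyPath G)
    {u s y z a b : V} (h3 : HasThreeFar G u) (hs : IsFar G u s) (hy : IsFar G u y)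
    (hz : IsFar G u z) (hyz : y ≠ z) (hytip : ¬ IsTip G u y) (hztip : ¬ IsTip G u z)
    (ha : G.Adj u a) (hb : G.Adj u b) (hab : G.Adj a b) (has : G.Adj a s)
    (hby : G.Adj b y) (hsy : G.Adj s y) (hsz : G.Adj s z) :
    G.IsHamiltonian := by
  have hcov : ∀ v, IsFar G u v → v = s ∨ v = y ∨ v = z := by
    intro v hv
    obtain ⟨w, _, _, _, hw⟩ := h3.third s y hs hy hsy.ne
    have : z = w := by
      rcases hw z hz with h | h | h
      · exact absurd h hsz.ne'
      · exact absurd h hyz.symm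
      · exact h
    simpa [this] using hw v hv
  obtain ⟨m, f, i, j, h, hij, hj, rfl, rfl⟩ :=
    hG.exists_isLinkEnum_lt hsy hsz hyz
  have succ : ∀ k, k < m → G.Adj (f k) (f (k + 1)) := fun k hk =>
    (h.adj_iff k hk.le (k + 1) hk).2 (Or.inl rfl)
  have near : ∀ k, i < k → k < j → G.Adj u (f k) := by
    intro k hk hkj
    by_contra hfk
    rcases hcov (f k) ⟨fun h' => hs.2 (h' ▸ (h.adj_center k (by omega)).symm), hfk⟩
      with h' | h' | h'
    · exact (h.adj_center k (by omega)).ne' h'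
    · have := h.inj _ (by omega) _ (by omega) h'
      omega
    · have := h.inj _ (by omega) _ (by omega) h'
      omega
  by_cases hj1 : j = i + 1
  · subst hj1
    exact h3.isHamiltonian_of_triple hG ha hb hab hs hz hy hsy.ne has hsz
      (succ i (by omega)).symm hby.symm
  have hr := near (i + 1) (by omega) (by omega)
  rcases hG.link_cases h3 hs hr (h.adj_center (i + 1) (by omega)).symm with
    h' | ⟨q, huq, hpq, hqs | ⟨w, hw, hws, hqw, hpw, _⟩⟩
  · exact h'
  · obtain ⟨k, hk, rfl⟩ := h.surj q hqs.symm
    have hk2 : k = i + 2 := by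
      rcases (h.adj_iff (i + 1) (by omega) k hk).1 hpq with h' | h'
      · exact h'.symm
      · obtain rfl : k = i := by omega
        exact absurd huq hy.2
    subst hk2
    have hj2 : j ≠ i + 2 := by
      rintro rfl
      exact hz.2 huq
    by_cases hj3 : j = i + 3
    · subst hj3
      exact h3.isHamiltonian_of_triple hG hr huq hpq hy hs hz hyz (succ i (by omega)).symm
        hsy.symm hsz (succ (i + 2) (by omega)).symm
    · have hr3 := near (i + 3) (by omega) (by omega)
      rcases hG.eq_of_four_cycle (v := f (i + 2)) huq.symm hpq.symm hqs
        (succ (i + 2) (by omega)) hr (h.adj_center (i + 1) (by omega)).symm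
        (h.adj_center (i + 3) (by omega)) hr3.symm with h' | h'
      · exact absurd h'.symm hs.1
      · have := h.inj _ (by omega) _ (by omega) h'
        omega
  · rcases hcov w hw with rfl | rfl | rfl
    · exact absurd rfl hws
    · exact absurd ⟨_, _, huq, hr, hpq.symm, hqw, hpw⟩ hytip
    · exact absurd ⟨_, _, huq, hr, hpq.symm, hqw, hpw⟩ hztip

/-- A locally linear graph with exactly three vertices outside some closed neighborhood is
Hamiltonian. -/
lemma HasThreeFar.isHamiltonian [Fintype V] [DecidableEq V] (hconn : G.Connected)
    (hG : LocallyPath G) {u : V} (h3 : HasThreeFar G u) : G.IsHamiltonian := by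
  by_cases hiso : ∃ z, IsFar G u z ∧ ∀ q, G.Adj u q → ¬ G.Adj z q
  · obtain ⟨z₀, hz₀⟩ := hiso
    obtain ⟨w⟩ := hconn.preconnected z₀ u
    obtain ⟨⟨⟨z, s⟩, hzs⟩, _, hz, hs⟩ := w.exists_boundary_dart
      {z | IsFar G u z ∧ ∀ q, G.Adj u q → ¬ G.Adj z q} hz₀ (fun h => h.1.1 rfl)
    simp only [Set.mem_ofPred_eq, not_and, not_forall, not_not] at hz hs hzs
    have hsf : IsFar G u s := by
      refine ⟨?_, fun h => hz.2 s h hzs⟩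
      rintro rfl
      exact hz.1.2 hzs.symm
    obtain ⟨p, hup, hsp⟩ := hs hsf
    exact h3.isHamiltonian_of_isolated hG hz.1 hz.2 hsf hzs.symm hup hsp
  push Not at hiso
  by_contra hham
  have tip_or : ∀ s, IsFar G u s → ¬ IsTip G u s → ∃ t p q, IsFar G u t ∧ t ≠ s ∧ G.Adj u q ∧
      G.Adj u p ∧ G.Adj q p ∧ G.Adj q t ∧ G.Adj p t ∧ G.Adj p s ∧ G.Adj t s := by
    intro s hs hnt
    obtain ⟨p, hup, hsp⟩ := hiso s hs
    rcases hG.link_cases h3 hs hup hsp.symm with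
      h' | ⟨q, huq, hpq, hqs | ⟨t, ht, hts, hqt, hpt, hts'⟩⟩
    · exact absurd h' hham
    · exact absurd ⟨_, _, huq, hup, hpq.symm, hqs, hsp.symm⟩ hnt
    · exact ⟨t, p, q, ht, hts, huq, hup, hpq.symm, hqt, hpt, hsp.symm, hts'⟩
  by_cases hall : ∀ s, IsFar G u s → IsTip G u s
  · obtain ⟨x, y, z, hxy, hxz, hyz, hcov⟩ := h3
    have hx := (hcov x).2 (by simp)
    have hy := (hcov y).2 (by simp)
    have hz := (hcov z).2 (by simp)
    obtain ⟨a, b, ha, hb, hab, hax, hbx⟩ := hall x hx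
    obtain ⟨c, d, hc, hd, hcd, hcy, hdy⟩ := hall y hy
    obtain ⟨e, g, he, hg, heg, hez, hgz⟩ := hall z hz
    refine hham (IsInsertion.isHamiltonian₃ (u := u) (a := ![a, c, e]) (b := ![b, d, g])
      (s := ![x, y, z]) ?_ hG ?_ ?_)
    · simp only [Fin.forall_fin_succ]
      exact ⟨.singleton ha hb hab hx hax hbx.symm, .singleton hc hd hcd hy hcy hdy.symm,
        .singleton he hg heg hz hez hgz.symm, fun i => i.elim0⟩
    · intro i j
      fin_cases i <;> fin_cases j <;> simp [*, Ne.symm]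
    · simpa [Fin.exists_fin_succ] using fun v => (hcov v).1
  push Not at hall
  obtain ⟨z, hz, hnz⟩ := hall
  obtain ⟨t, p, q, ht, htz, huq, hup, hqp, hqt, hpt, hpz, htz'⟩ := tip_or z hz hnz
  obtain ⟨s, hs, hst, hsz, hcov⟩ := h3.third t z ht hz htz
  by_cases hstip : IsTip G u s
  · obtain ⟨a, b, ha, hb, hab, has, hbs⟩ := hstip
    refine hham ((IsInsertion.pair huq hup hqp ht hz hqt htz' hpz.symm).isHamiltonian₂
      (.singleton ha hb hab hs has hbs.symm) hG
      (hG.base_ne huq hup hqp ht hs hqt hpt has hbs hst.symm) ?_ ?_)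
    · simp [hst.symm, hsz.symm]
    · intro v hv
      simpa [or_assoc] using hcov v hv
  · obtain ⟨t', p', q', ht', hts', huq', hup', hqp', hqt', hpt', hps', htadj⟩ :=
      tip_or s hs hstip
    obtain rfl : t' = t := by
      rcases hcov t' ht' with h | rfl | h
      · exact h
      · exact absurd ⟨_, _, huq', hup', hqp', hqt', hpt'⟩ hnz
      · exact absurd h hts'
    exact hham (h3.isHamiltonian_of_unique_tip hG ht hz hs hsz.symm hnz hstip huq hup hqp hqt
      hpz htz' htadj)

end

/-- Any locally linear graph on `n` vertices with a vertex of degree `n - 4`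
is hamiltonian. -/
theorem stmt_17 {V : Type*} [Fintype V] [DecidableEq V] (G : SimpleGraph V)
    [DecidableRel G.Adj]
    (hconn : G.Connected) (hG : LocallyPath G)
    (u : V) (hu : G.degree u = Fintype.card V - 4) :
    G.IsHamiltonian := by
  have hpos : 0 < G.degree u := by
    obtain ⟨m, f, h⟩ := hG.exists_isLinkEnum u
    exact (G.degree_pos_iff_exists_adj u).2 ⟨_, h.adj_center 0 (by omega)⟩
  have hcard : (insert u (G.neighborFinset u))ᶜ.card = 3 := by
    rw [Finset.card_compl, Finset.card_insert_of_notMem (by simp), G.card_neighborFinset_eq_degree]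
    omega
  have hmem : ∀ s, s ∈ (insert u (G.neighborFinset u))ᶜ ↔ IsFar G u s := by
    simp [IsFar]
  obtain ⟨x, y, z, hxy, hxz, hyz, hS⟩ := Finset.card_eq_three.1 hcard
  refine HasThreeFar.isHamiltonian hconn hG (u := u) ⟨x, y, z, hxy, hxz, hyz, fun s => ?_⟩
  rw [← hmem, hS]
  simp
end
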